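/- For every σ ∈ ℝ, the assignment γ_i^{±1} ↦ C_i^{±1} (1 ≤ i ≤ 2n), β_j ↦ B_j (j ∈ {1,…,2n−1}, j ≠ n), β_n ↦ B_n^σ extends (necessarily uniquely) to an algebra homomorphism π_σ : 𝒜 → U_q(g), and π_σ is injective; in particular π_σ is an algebra isomorphism from 𝒜 onto the subalgebra 𝒜_σ. -/

import Mathlib

namespace QG

/-- Generators of the quantized universal enveloping algebra `U_q(gl(m))`:
`K i`, its inverse `Ki i`, and the Chevalley generators `E j` (the `x_j`)
and `F j` (the `y_j`).  Indices are 1-based natural numbers; out-of-range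
generators are forced to be `1` (resp. `0`) by the relations. -/
inductive Gen : Type where
  | K : ℕ → Gen
  | Ki : ℕ → Gen
  | E : ℕ → Gen
  | F : ℕ → Gen

abbrev FA := FreeAlgebra ℂ Gen

noncomputable def fK (i : ℕ) : FA := FreeAlgebra.ι ℂ (Gen.K i)
noncomputable def fKi (i : ℕ) : FA := FreeAlgebra.ι ℂ (Gen.Ki i)
noncomputable def fE (i : ℕ) : FA := FreeAlgebra.ι ℂ (Gen.E i)
noncomputable def fF (i : ℕ) : FA := FreeAlgebra.ι ℂ (Gen.F i)

/-- Kronecker delta with values in `ℤ`. -/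
def kd (i j : ℕ) : ℤ := if i = j then 1 else 0

/-- The defining relations of `U_q(gl(m))`. -/
inductive Rel (q : ℝ) (m : ℕ) : FA → FA → Prop
  | Kout : ∀ i, ¬(1 ≤ i ∧ i ≤ m) → Rel q m (fK i) 1
  | Kiout : ∀ i, ¬(1 ≤ i ∧ i ≤ m) → Rel q m (fKi i) 1
  | Eout : ∀ j, ¬(1 ≤ j ∧ j + 1 ≤ m) → Rel q m (fE j) 0
  | Fout : ∀ j, ¬(1 ≤ j ∧ j + 1 ≤ m) → Rel q m (fF j) 0
  | KK : ∀ i j, Rel q m (fK i * fK j) (fK j * fK i)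
  | KKi : ∀ i, Rel q m (fK i * fKi i) 1
  | KiK : ∀ i, Rel q m (fKi i * fK i) 1
  | KE : ∀ i j, 1 ≤ i → i ≤ m → 1 ≤ j → j + 1 ≤ m →
      Rel q m (fK i * fE j) (((q : ℂ) ^ (kd i j - kd i (j+1))) • (fE j * fK i))
  | KF : ∀ i j, 1 ≤ i → i ≤ m → 1 ≤ j → j + 1 ≤ m →
      Rel q m (fK i * fF j) (((q : ℂ) ^ (kd i (j+1) - kd i j)) • (fF j * fK i))
  | EF : ∀ i j, 1 ≤ i → i + 1 ≤ m → 1 ≤ j → j + 1 ≤ m →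
      Rel q m (fE i * fF j - fF j * fE i)
        (if i = j then ((q : ℂ) - (q : ℂ)⁻¹)⁻¹ • (fK i * fKi (i+1) - fKi i * fK (i+1)) else 0)
  | EE : ∀ i j, 1 ≤ i → i + 1 ≤ m → 1 ≤ j → j + 1 ≤ m → (i + 2 ≤ j ∨ j + 2 ≤ i) →
      Rel q m (fE i * fE j) (fE j * fE i)
  | FF : ∀ i j, 1 ≤ i → i + 1 ≤ m → 1 ≤ j → j + 1 ≤ m → (i + 2 ≤ j ∨ j + 2 ≤ i) →
      Rel q m (fF i * fF j) (fF j * fF i)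
  | Eserre : ∀ i j, 1 ≤ i → i + 1 ≤ m → 1 ≤ j → j + 1 ≤ m → (i + 1 = j ∨ j + 1 = i) →
      Rel q m (fE i ^ 2 * fE j - ((q : ℂ) + (q : ℂ)⁻¹) • (fE i * fE j * fE i) + fE j * fE i ^ 2) 0
  | Fserre : ∀ i j, 1 ≤ i → i + 1 ≤ m → 1 ≤ j → j + 1 ≤ m → (i + 1 = j ∨ j + 1 = i) →
      Rel q m (fF i ^ 2 * fF j - ((q : ℂ) + (q : ℂ)⁻¹) • (fF i * fF j * fF i) + fF j * fF i ^ 2) 0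

/-- The quantized universal enveloping algebra `U_q(gl(m))`. -/
abbrev Uq (q : ℝ) (m : ℕ) := RingQuot (Rel q m)

noncomputable def uK (q : ℝ) (m i : ℕ) : Uq q m := RingQuot.mkAlgHom ℂ (Rel q m) (fK i)
noncomputable def uKi (q : ℝ) (m i : ℕ) : Uq q m := RingQuot.mkAlgHom ℂ (Rel q m) (fKi i)
noncomputable def uE (q : ℝ) (m i : ℕ) : Uq q m := RingQuot.mkAlgHom ℂ (Rel q m) (fE i)
noncomputable def uF (q : ℝ) (m i : ℕ) : Uq q m := RingQuot.mkAlgHom ℂ (Rel q m) (fF i)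

/-- `C_i = K_i K_{2n+1-i}` in `U_q(gl(2n))`. -/
noncomputable def Cc (q : ℝ) (n i : ℕ) : Uq q (2*n) := uK q (2*n) i * uK q (2*n) (2*n+1-i)
/-- `C_i⁻¹ = K_i⁻¹ K_{2n+1-i}⁻¹` in `U_q(gl(2n))`. -/
noncomputable def Ccinv (q : ℝ) (n i : ℕ) : Uq q (2*n) := uKi q (2*n) i * uKi q (2*n) (2*n+1-i)
/-- `B_j = y_j K_{j+1}⁻¹ K_{2n-j}⁻¹ + K_j⁻¹ x_{2n-j} K_{2n-j}⁻¹` in `U_q(gl(2n))`. -/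
noncomputable def Bb (q : ℝ) (n j : ℕ) : Uq q (2*n) :=
  uF q (2*n) j * uKi q (2*n) (j+1) * uKi q (2*n) (2*n-j)
  + uKi q (2*n) j * uE q (2*n) (2*n-j) * uKi q (2*n) (2*n-j)
/-- `B_n^σ = y_n K_{n+1}⁻¹ K_n⁻¹ + K_n⁻¹ x_n K_n⁻¹ + ((q^{-σ}-q^{σ})/(q-q⁻¹)) K_n⁻²`. -/
noncomputable def Bs (q σ : ℝ) (n : ℕ) : Uq q (2*n) :=
  uF q (2*n) n * uKi q (2*n) (n+1) * uKi q (2*n) n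
  + uKi q (2*n) n * uE q (2*n) n * uKi q (2*n) n
  + (((q ^ (-σ) - q ^ σ) / (q - q⁻¹) : ℝ) : ℂ) • ((uKi q (2*n) n)^2)

/-- The generating set of the coideal subalgebra `𝒜_σ ⊆ U_q(gl(2n))`. -/
def ASet (q σ : ℝ) (n : ℕ) : Set (Uq q (2*n)) :=
  {z | (∃ i, 1 ≤ i ∧ i ≤ 2*n ∧ (z = Cc q n i ∨ z = Ccinv q n i)) ∨
       (∃ j, 1 ≤ j ∧ j + 1 ≤ 2*n ∧ j ≠ n ∧ z = Bb q n j) ∨ z = Bs q σ n}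

/-- Generators of the abstract algebra `𝒜`. -/
inductive AGen : Type where
  | g : ℕ → AGen
  | gi : ℕ → AGen
  | b : ℕ → AGen

abbrev AFA := FreeAlgebra ℂ AGen

noncomputable def fγ (i : ℕ) : AFA := FreeAlgebra.ι ℂ (AGen.g i)
noncomputable def fγi (i : ℕ) : AFA := FreeAlgebra.ι ℂ (AGen.gi i)
noncomputable def fβ (j : ℕ) : AFA := FreeAlgebra.ι ℂ (AGen.b j)

/-- `(ε_i + ε_{2n+1-i}, α_j)` where `α_j = ε_j - ε_{j+1}`. -/
def gex (n i j : ℕ) : ℤ := kd i j + kd (2*n+1-i) j - kd i (j+1) - kd (2*n+1-i) (j+1)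

/-- The defining relations of the algebra `𝒜`. -/
inductive ARel (q : ℝ) (n : ℕ) : AFA → AFA → Prop
  | gout : ∀ i, ¬(1 ≤ i ∧ i ≤ 2*n) → ARel q n (fγ i) 1
  | giout : ∀ i, ¬(1 ≤ i ∧ i ≤ 2*n) → ARel q n (fγi i) 1
  | bout : ∀ j, ¬(1 ≤ j ∧ j + 1 ≤ 2*n) → ARel q n (fβ j) 0
  | gg : ∀ i j, ARel q n (fγ i * fγ j) (fγ j * fγ i)
  | ggi : ∀ i, ARel q n (fγ i * fγi i) 1
  | gig : ∀ i, ARel q n (fγi i * fγ i) 1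
  | gsym : ∀ i, 1 ≤ i → i ≤ 2*n → ARel q n (fγ i) (fγ (2*n+1-i))
  | gb : ∀ i j, 1 ≤ i → i ≤ 2*n → 1 ≤ j → j + 1 ≤ 2*n →
      ARel q n (fγ i * fβ j) (((q : ℂ) ^ (-(gex n i j))) • (fβ j * fγ i))
  | bb : ∀ i j, 1 ≤ i → i + 1 ≤ 2*n → 1 ≤ j → j + 1 ≤ 2*n → (i + 2 ≤ j ∨ j + 2 ≤ i) →
      ARel q n (fβ i * fβ j - fβ j * fβ i)
        (if i + j = 2*n then ((q : ℂ) * ((q : ℂ) - (q : ℂ)⁻¹)⁻¹) • (fγi i ^ 2 - fγi (i+1) ^ 2)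
         else 0)
  | serre1 : ∀ i, 1 ≤ i → i + 2 ≤ 2*n →
      ARel q n
        ((q : ℂ)⁻¹ • (fβ i ^ 2 * fβ (i+1)) - ((q : ℂ) + (q : ℂ)⁻¹) • (fβ i * fβ (i+1) * fβ i)
          + (q : ℂ) • (fβ (i+1) * fβ i ^ 2))
        (if i = n then (q : ℂ) • (fβ (n+1) * fγi n ^ 2) else 0)
  | serre2 : ∀ i, 2 ≤ i → i + 1 ≤ 2*n →
      ARel q n
        ((q : ℂ) • (fβ i ^ 2 * fβ (i-1)) - ((q : ℂ) + (q : ℂ)⁻¹) • (fβ i * fβ (i-1) * fβ i)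
          + (q : ℂ)⁻¹ • (fβ (i-1) * fβ i ^ 2))
        (if i = n then (q : ℂ)⁻¹ • (fβ (n-1) * fγi n ^ 2) else 0)

/-- The abstract algebra `𝒜`. -/
abbrev Aalg (q : ℝ) (n : ℕ) := RingQuot (ARel q n)

noncomputable def aγ (q : ℝ) (n i : ℕ) : Aalg q n := RingQuot.mkAlgHom ℂ (ARel q n) (fγ i)
noncomputable def aγi (q : ℝ) (n i : ℕ) : Aalg q n := RingQuot.mkAlgHom ℂ (ARel q n) (fγi i)
noncomputable def aβ (q : ℝ) (n j : ℕ) : Aalg q n := RingQuot.mkAlgHom ℂ (ARel q n) (fβ j)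

end QG

namespace QG

section QCommutation

variable {A : Type*} [Ring A] [Algebra ℂ A]

/-- The twisted quantum Serre polynomial. -/
noncomputable def Tp (p s : ℂ) (a b : A) : A :=
  p⁻¹ • (a ^ 2 * b) - s • (a * b * a) + p • (b * a ^ 2)

theorem Tp_add_right (p s : ℂ) (a b c : A) : Tp p s a (b + c) = Tp p s a b + Tp p s a c := by
  simp only [Tp, mul_add, add_mul, smul_add]; abel

theorem Tp_twist {p p' s a b d : ℂ} {F G W W' : A} (hS : Tp p s F G = 0)
    (hWF : W * F = d • (F * W)) (hWG : W * G = a • (G * W)) (hW'F : W' * F = b • (F * W'))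
    (hWW : W * W' = W' * W) (hp : p ≠ 0) (hp' : p' ≠ 0) (h : a * p = p' * b) :
    Tp p' s (F * W) (G * W') = 0 := by
  have r1 : ∀ x, W * (F * x) = d • (F * (W * x)) := fun x => by
    rw [← mul_assoc, hWF, smul_mul_assoc, mul_assoc]
  have r2 : ∀ x, W * (G * x) = a • (G * (W * x)) := fun x => by
    rw [← mul_assoc, hWG, smul_mul_assoc, mul_assoc]
  have r3 : ∀ x, W' * (F * x) = b • (F * (W' * x)) := fun x => by
    rw [← mul_assoc, hW'F, smul_mul_assoc, mul_assoc]
  have r4 : ∀ x, W' * (W * x) = W * (W' * x) := fun x => by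
    rw [← mul_assoc, ← hWW, mul_assoc]
  have key : Tp p' s (F * W) (G * W') = (a * b * d) • (Tp p s F G * (W * (W * W'))) := by
    have h1 : a = p' * b * p⁻¹ := by field_simp; exact h
    simp only [Tp, pow_two, mul_assoc, r1, r2, r3, r4, mul_smul_comm, smul_mul_assoc, smul_smul,
      sub_mul, add_mul, ← hWW, h1]
    match_scalars <;> field_simp
  rw [key, hS, zero_mul, smul_zero]

theorem Tp_sum_of_commute {p u w t : ℂ} {X Y k g b : A} (hp : p ≠ 0)
    (hS : Tp p (p + p⁻¹) X b = 0) (hYb : Y * b = b * Y)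
    (hXY : X * Y = (p ^ 2)⁻¹ • (Y * X) + u • g + w • (k * k))
    (hkb : k * b = b * k) (hgb : g * b = p ^ 2 • (b * g))
    (hkX : k * X = p ^ 2 • (X * k)) (hkY : k * Y = (p ^ 2)⁻¹ • (Y * k)) :
    Tp p (p + p⁻¹) (X + Y + t • k) b = (p * (1 - p ^ 2) * u) • (b * g) := by
  have hXk : X * k = (p ^ 2)⁻¹ • (k * X) := by rw [hkX, smul_smul, inv_mul_cancel₀ (by positivity),
      one_smul]
  have hYk : Y * k = p ^ 2 • (k * Y) := by rw [hkY, smul_smul, mul_inv_cancel₀ (by positivity),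
      one_smul]
  have r1 : ∀ x, X * (Y * x) = (p ^ 2)⁻¹ • (Y * (X * x)) + u • (g * x) + w • (k * (k * x)) :=
    fun x => by rw [← mul_assoc, hXY]; simp only [add_mul, smul_mul_assoc, mul_assoc]
  have r2 : ∀ x, b * (Y * x) = Y * (b * x) := fun x => by rw [← mul_assoc, ← hYb, mul_assoc]
  have r3 : ∀ x, X * (k * x) = (p ^ 2)⁻¹ • (k * (X * x)) := fun x => by
    rw [← mul_assoc, hXk, smul_mul_assoc, mul_assoc]
  have r4 : ∀ x, Y * (k * x) = p ^ 2 • (k * (Y * x)) := fun x => by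
    rw [← mul_assoc, hYk, smul_mul_assoc, mul_assoc]
  have r5 : ∀ x, b * (k * x) = k * (b * x) := fun x => by rw [← mul_assoc, ← hkb, mul_assoc]
  have hS' : X * (X * b) = (p * (p + p⁻¹)) • (X * (b * X)) - (p * p) • (b * (X * X)) := by
    have := congrArg (fun x => p • x) hS
    simp only [Tp, smul_add, smul_sub, smul_smul, mul_inv_cancel₀ hp, one_smul, smul_zero, pow_two,
      mul_assoc] at this
    rw [← sub_eq_zero, ← this]; module
  simp only [Tp, pow_two, mul_add, add_mul, mul_assoc, smul_mul_assoc, mul_smul_comm, hXY, r1, r2,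
    ← hYb, hXk, r3, hYk, r4, ← hkb, r5, hgb, hS', smul_add, smul_sub, smul_smul]
  match_scalars <;> field_simp <;> ring

theorem Tp_sum_of_twisted_commute {p u w t : ℂ} {X Y k g b : A} (hp : p ≠ 0)
    (hS : Tp p (p + p⁻¹) X b = 0) (hYb : Y * b = p ^ 2 • (b * Y))
    (hXY : X * Y = p ^ 2 • (Y * X) + u • g + w • (k * k))
    (hkb : k * b = p ^ 2 • (b * k)) (hgb : g * b = p ^ 2 • (b * g))
    (hkX : k * X = (p ^ 2)⁻¹ • (X * k)) (hkY : k * Y = p ^ 2 • (Y * k)) :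
    Tp p (p + p⁻¹) (X + Y + t • k) b = ((p - p⁻¹) * u) • (b * g) := by
  have hp2 : p ^ 2 ≠ 0 := by positivity
  have hXk : X * k = p ^ 2 • (k * X) := by rw [hkX, smul_smul, mul_inv_cancel₀ hp2, one_smul]
  have hYk : Y * k = (p ^ 2)⁻¹ • (k * Y) := by rw [hkY, smul_smul, inv_mul_cancel₀ hp2, one_smul]
  have hbY : b * Y = (p ^ 2)⁻¹ • (Y * b) := by rw [hYb, smul_smul, inv_mul_cancel₀ hp2, one_smul]
  have hbk : b * k = (p ^ 2)⁻¹ • (k * b) := by rw [hkb, smul_smul, inv_mul_cancel₀ hp2, one_smul]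
  have r1 : ∀ x, X * (Y * x) = p ^ 2 • (Y * (X * x)) + u • (g * x) + w • (k * (k * x)) :=
    fun x => by rw [← mul_assoc, hXY]; simp only [add_mul, smul_mul_assoc, mul_assoc]
  have r2 : ∀ x, b * (Y * x) = (p ^ 2)⁻¹ • (Y * (b * x)) := fun x => by
    rw [← mul_assoc, hbY, smul_mul_assoc, mul_assoc]
  have r3 : ∀ x, X * (k * x) = p ^ 2 • (k * (X * x)) := fun x => by
    rw [← mul_assoc, hXk, smul_mul_assoc, mul_assoc]
  have r4 : ∀ x, Y * (k * x) = (p ^ 2)⁻¹ • (k * (Y * x)) := fun x => by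
    rw [← mul_assoc, hYk, smul_mul_assoc, mul_assoc]
  have r5 : ∀ x, b * (k * x) = (p ^ 2)⁻¹ • (k * (b * x)) := fun x => by
    rw [← mul_assoc, hbk, smul_mul_assoc, mul_assoc]
  have hS' : X * (X * b) = (p * (p + p⁻¹)) • (X * (b * X)) - (p * p) • (b * (X * X)) := by
    have := congrArg (fun x => p • x) hS
    simp only [Tp, smul_add, smul_sub, smul_smul, mul_inv_cancel₀ hp, one_smul, smul_zero, pow_two,
      mul_assoc] at this
    rw [← sub_eq_zero, ← this]; module
  simp only [Tp, pow_two, mul_add, add_mul, mul_assoc, smul_mul_assoc, mul_smul_comm, hXY, r1, r2,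
    hbY, hXk, r3, hYk, r4, hbk, r5, hgb, hS', smul_add, smul_sub, smul_smul]
  match_scalars <;> field_simp <;> ring

/-- The first-order variation of the Serre polynomial in its repeated argument vanishes. -/
theorem serre_variation_left {q u : ℂ} {a b H H' : A} (hq : q ≠ 0)
    (hHa : H * a = (q ^ 2)⁻¹ • (a * H)) (hH'a : H' * a = q ^ 2 • (a * H'))
    (hHb : H * b = q • (b * H)) (hH'b : H' * b = q⁻¹ • (b * H')) :
    (u • (H - H') * a + a * u • (H - H')) * b
      - (q + q⁻¹) • (u • (H - H') * b * a + a * b * u • (H - H'))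
      + b * (u • (H - H') * a + a * u • (H - H')) = 0 := by
  simp only [mul_add, add_mul, mul_sub, sub_mul, mul_assoc, smul_mul_assoc, mul_smul_comm,
    hHa, hHb, hH'a, hH'b, smul_add, smul_sub, smul_smul]
  match_scalars <;> field_simp <;> ring

/-- The first-order variation of the Serre polynomial in its simple argument vanishes. -/
theorem serre_variation_right {q u : ℂ} {a H H' : A} (hq : q ≠ 0)
    (hHa : H * a = q • (a * H)) (hH'a : H' * a = q⁻¹ • (a * H')) :
    a ^ 2 * u • (H - H') - (q + q⁻¹) • (a * u • (H - H') * a) + u • (H - H') * a ^ 2 = 0 := by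
  have r1 : ∀ x, H * (a * x) = q • (a * (H * x)) := fun x => by
    rw [← mul_assoc, hHa, smul_mul_assoc, mul_assoc]
  have r2 : ∀ x, H' * (a * x) = q⁻¹ • (a * (H' * x)) := fun x => by
    rw [← mul_assoc, hH'a, smul_mul_assoc, mul_assoc]
  simp only [pow_two, mul_sub, sub_mul, mul_assoc, smul_mul_assoc, mul_smul_comm, r1, r2,
    hHa, hH'a, smul_sub, smul_smul]
  match_scalars <;> field_simp <;> ring

theorem Tp_mul_sub_mul_Tp {s : ℂ} {a b F α β : A} (hα : a * F = F * a + α)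
    (hβ : b * F = F * b + β) :
    Tp 1 s a b * F = F * Tp 1 s a b
      + ((α * a + a * α) * b - s • (α * b * a + a * b * α) + b * (α * a + a * α))
      + (a ^ 2 * β - s • (a * β * a) + β * a ^ 2) := by
  have r1 : ∀ x, a * (F * x) = F * (a * x) + α * x := fun x => by
    rw [← mul_assoc, hα, add_mul, mul_assoc]
  have r2 : ∀ x, b * (F * x) = F * (b * x) + β * x := fun x => by
    rw [← mul_assoc, hβ, add_mul, mul_assoc]
  simp only [Tp, pow_two, mul_add, add_mul, sub_mul, mul_sub, mul_assoc, smul_mul_assoc,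
    mul_smul_comm, hα, hβ, r1, r2, smul_add, inv_one, one_smul]
  module

end QCommutation

section QExponents

variable {A : Type*} [Ring A] [Algebra ℂ A]

/-- `a` and `b` commute up to the factor `q ^ k`. -/
def QE (q : ℂ) (k : ℤ) (a b : A) : Prop := a * b = q ^ k • (b * a)

variable {q : ℂ} {k l : ℤ} {a a' b b' : A}

theorem QE.mul_left (hq : q ≠ 0) (h : QE q k a b) (h' : QE q l a' b) :
    QE q (k + l) (a * a') b := by
  unfold QE at *
  rw [mul_assoc, h', mul_smul_comm, ← mul_assoc, h, smul_mul_assoc, smul_smul, mul_assoc,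
    zpow_add₀ hq, mul_comm]

theorem QE.mul_right (hq : q ≠ 0) (h : QE q k a b) (h' : QE q l a b') :
    QE q (k + l) a (b * b') := by
  unfold QE at *
  rw [← mul_assoc, h, smul_mul_assoc, mul_assoc, h', mul_smul_comm, smul_smul, mul_assoc,
    zpow_add₀ hq]

theorem QE.symm (hq : q ≠ 0) (h : QE q k a b) : QE q (-k) b a := by
  unfold QE at *
  rw [h, smul_smul, ← zpow_add₀ hq, neg_add_cancel, zpow_zero, one_smul]

theorem QE.inv_left (hq : q ≠ 0) (h : QE q k a b) (h₁ : a * a' = 1) (h₂ : a' * a = 1) :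
    QE q (-k) a' b := by
  have : a' * (a * b) * a' = q ^ k • (a' * (b * a) * a') := by
    rw [show a * b = q ^ k • (b * a) from h, mul_smul_comm, smul_mul_assoc]
  rw [← mul_assoc, h₂, one_mul, mul_assoc, mul_assoc, h₁, mul_one] at this
  unfold QE
  rw [this, smul_smul, ← zpow_add₀ hq, neg_add_cancel, zpow_zero, one_smul]

theorem QE.of_comm (h : a * b = b * a) : QE q 0 a b := by
  unfold QE
  rw [zpow_zero, one_smul, h]

theorem QE.congr (h : QE q k a b) (hk : k = l) : QE q l a b := hk ▸ h

end QExponents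

section Representations

variable {A B : Type*} [Ring A] [Algebra ℂ A] [Ring B] [Algebra ℂ B]

/-- An invertible commuting family `K` acting on the family `F` by the weights of the `y_j`. -/
structure Weights (q : ℂ) (K Ki F : ℕ → A) : Prop where
  KK : ∀ i j, K i * K j = K j * K i
  KKi : ∀ i, K i * Ki i = 1
  KiK : ∀ i, Ki i * K i = 1
  KF : ∀ i j, QE q (kd i (j + 1) - kd i j) (K i) (F j)

/-- Elements satisfying the defining relations of the nonpositive part of `U_q(gl(m))`. -/
structure Borel (q : ℂ) (m : ℕ) (K Ki F : ℕ → A) : Prop extends Weights q K Ki F where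
  K_out : ∀ i, ¬(1 ≤ i ∧ i ≤ m) → K i = 1
  Ki_out : ∀ i, ¬(1 ≤ i ∧ i ≤ m) → Ki i = 1
  F_out : ∀ j, ¬(1 ≤ j ∧ j + 1 ≤ m) → F j = 0
  FF : ∀ i j, (i + 2 ≤ j ∨ j + 2 ≤ i) → F i * F j = F j * F i
  serre : ∀ i j, (i + 1 = j ∨ j + 1 = i) → Tp 1 (q + q⁻¹) (F i) (F j) = 0

namespace Weights

variable {q : ℂ} {K Ki F : ℕ → A}

theorem K_comm_Ki (h : Weights q K Ki F) (i j : ℕ) : K i * Ki j = Ki j * K i :=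
  calc K i * Ki j = Ki j * (K j * K i) * Ki j := by rw [← mul_assoc, h.KiK, one_mul]
    _ = Ki j * K i := by rw [h.KK, mul_assoc, mul_assoc, h.KKi, mul_one]

theorem Ki_comm (h : Weights q K Ki F) (i j : ℕ) : Ki i * Ki j = Ki j * Ki i :=
  calc Ki i * Ki j = Ki j * (K j * Ki i) * Ki j := by rw [← mul_assoc, h.KiK, one_mul]
    _ = Ki j * Ki i := by rw [h.K_comm_Ki, mul_assoc, mul_assoc, h.KKi, mul_one]

theorem KiF (hq : q ≠ 0) (h : Weights q K Ki F) (i j : ℕ) :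
    QE q (kd i j - kd i (j + 1)) (Ki i) (F j) :=
  ((h.KF i j).inv_left hq (h.KKi i) (h.KiK i)).congr (by ring)

end Weights

/-- Elements satisfying the defining relations of `U_q(gl(m))`. -/
structure UqRep (q : ℂ) (m : ℕ) (K Ki E F : ℕ → A) : Prop where
  neg : Borel q m K Ki F
  pos : Borel q m Ki K E
  EF_ne : ∀ i j, i ≠ j → E i * F j = F j * E i
  EF : ∀ i, 1 ≤ i → i + 1 ≤ m →
    E i * F i - F i * E i = (q - q⁻¹)⁻¹ • (K i * Ki (i + 1) - Ki i * K (i + 1))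

theorem uqRep_uq (q : ℝ) (hq : q ≠ 0) (m : ℕ) :
    UqRep (q : ℂ) m (uK q m) (uKi q m) (uE q m) (uF q m) := by
  have hq' : (q : ℂ) ≠ 0 := by exact_mod_cast hq
  have rel : ∀ {x y}, Rel q m x y → RingQuot.mkAlgHom ℂ (Rel q m) x =
      RingQuot.mkAlgHom ℂ (Rel q m) y :=
    fun h => RingQuot.mkAlgHom_rel ℂ h
  have Kout : ∀ i, ¬(1 ≤ i ∧ i ≤ m) → uK q m i = 1 := fun i hi => by
    simpa [uK] using rel (Rel.Kout i hi)
  have Kiout : ∀ i, ¬(1 ≤ i ∧ i ≤ m) → uKi q m i = 1 := fun i hi => by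
    simpa [uKi] using rel (Rel.Kiout i hi)
  have Eout : ∀ i, ¬(1 ≤ i ∧ i + 1 ≤ m) → uE q m i = 0 := fun i hi => by
    simpa [uE] using rel (Rel.Eout i hi)
  have Fout : ∀ i, ¬(1 ≤ i ∧ i + 1 ≤ m) → uF q m i = 0 := fun i hi => by
    simpa [uF] using rel (Rel.Fout i hi)
  have KKi : ∀ i, uK q m i * uKi q m i = 1 := fun i => by
    simpa [uKi, uK] using rel (Rel.KKi i)
  have KiK : ∀ i, uKi q m i * uK q m i = 1 := fun i => by
    simpa [uKi, uK] using rel (Rel.KiK i)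
  have kd_out : ∀ i j, ¬(1 ≤ i ∧ i ≤ m) → 1 ≤ j → j + 1 ≤ m → kd i j = 0 ∧ kd i (j + 1) = 0 := by
    intro i j hi h1 h2
    constructor <;> rw [kd, if_neg (by omega)]
  have KE : ∀ i j, QE (q : ℂ) (kd i j - kd i (j + 1)) (uK q m i) (uE q m j) := by
    intro i j
    by_cases hj : 1 ≤ j ∧ j + 1 ≤ m
    · by_cases hi : 1 ≤ i ∧ i ≤ m
      · simpa [QE, uK, uE] using rel (Rel.KE i j hi.1 hi.2 hj.1 hj.2)
      · simp [QE, Kout i hi, kd_out i j hi hj.1 hj.2]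
    · simp [QE, Eout j hj]
  have KF : ∀ i j, QE (q : ℂ) (kd i (j + 1) - kd i j) (uK q m i) (uF q m j) := by
    intro i j
    by_cases hj : 1 ≤ j ∧ j + 1 ≤ m
    · by_cases hi : 1 ≤ i ∧ i ≤ m
      · simpa [QE, uK, uF] using rel (Rel.KF i j hi.1 hi.2 hj.1 hj.2)
      · simp [QE, Kout i hi, kd_out i j hi hj.1 hj.2]
    · simp [QE, Fout j hj]
  have neg : Borel (q : ℂ) m (uK q m) (uKi q m) (uF q m) :=
    { K_out := Kout
      Ki_out := Kiout
      F_out := Fout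
      KK := fun i j => by simpa [uK] using rel (Rel.KK i j)
      KKi := KKi
      KiK := KiK
      KF := KF
      FF := fun i j hij => by
        by_cases hi : 1 ≤ i ∧ i + 1 ≤ m
        · by_cases hj : 1 ≤ j ∧ j + 1 ≤ m
          · simpa [uF] using rel (Rel.FF i j hi.1 hi.2 hj.1 hj.2 hij)
          · simp [Fout j hj]
        · simp [Fout i hi]
      serre := fun i j hij => by
        by_cases hi : 1 ≤ i ∧ i + 1 ≤ m
        · by_cases hj : 1 ≤ j ∧ j + 1 ≤ m
          · simpa [uF, Tp] using rel (Rel.Fserre i j hi.1 hi.2 hj.1 hj.2 hij)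
          · simp [Tp, Fout j hj]
        · simp [Tp, Fout i hi] }
  refine ⟨neg, ?_, fun i j hij => ?_, fun i h1 h2 => ?_⟩
  · exact
    { K_out := Kiout
      Ki_out := Kout
      F_out := Eout
      KK := neg.Ki_comm
      KKi := KiK
      KiK := KKi
      KF := fun i j => ((KE i j).inv_left hq' (KKi i) (KiK i)).congr (by ring)
      FF := fun i j hij => by
        by_cases hi : 1 ≤ i ∧ i + 1 ≤ m
        · by_cases hj : 1 ≤ j ∧ j + 1 ≤ m
          · simpa [uE] using rel (Rel.EE i j hi.1 hi.2 hj.1 hj.2 hij)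
          · simp [Eout j hj]
        · simp [Eout i hi]
      serre := fun i j hij => by
        by_cases hi : 1 ≤ i ∧ i + 1 ≤ m
        · by_cases hj : 1 ≤ j ∧ j + 1 ≤ m
          · simpa [uE, Tp] using rel (Rel.Eserre i j hi.1 hi.2 hj.1 hj.2 hij)
          · simp [Tp, Eout j hj]
        · simp [Tp, Eout i hi] }
  · by_cases hi : 1 ≤ i ∧ i + 1 ≤ m
    · by_cases hj : 1 ≤ j ∧ j + 1 ≤ m
      · simpa [uE, uF, hij, sub_eq_zero] using rel (Rel.EF i j hi.1 hi.2 hj.1 hj.2)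
      · simp [Fout j hj]
    · simp [Eout i hi]
  · simpa [uE, uF, uK, uKi] using rel (Rel.EF i i h1 h2 h1 h2)

/-- The homomorphism from the free algebra underlying `UqRep.lift`. -/
noncomputable def freeLift (K Ki E F : ℕ → A) : FA →ₐ[ℂ] A :=
  FreeAlgebra.lift ℂ fun
    | .K i => K i
    | .Ki i => Ki i
    | .E i => E i
    | .F i => F i

theorem UqRep.freeLift_rel {q : ℝ} (hq : q ≠ 0) {m : ℕ} {K Ki E F : ℕ → A}
    (h : UqRep (q : ℂ) m K Ki E F) ⦃x y : FA⦄ (hxy : Rel q m x y) :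
    freeLift K Ki E F x = freeLift K Ki E F y := by
  have hq' : (q : ℂ) ≠ 0 := by exact_mod_cast hq
  have kE : ∀ i, freeLift K Ki E F (fE i) = E i := fun i => by simp [freeLift, fE]
  have kF : ∀ i, freeLift K Ki E F (fF i) = F i := fun i => by simp [freeLift, fF]
  have kK : ∀ i, freeLift K Ki E F (fK i) = K i := fun i => by simp [freeLift, fK]
  have kKi : ∀ i, freeLift K Ki E F (fKi i) = Ki i := fun i => by simp [freeLift, fKi]
  cases hxy with
  | Kout i hi => simpa [kK] using h.neg.K_out i hi
  | Kiout i hi => simpa [kKi] using h.neg.Ki_out i hi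
  | Eout i hi => simpa [kE] using h.pos.F_out i hi
  | Fout i hi => simpa [kF] using h.neg.F_out i hi
  | KK i j => simpa [kK] using h.neg.KK i j
  | KKi i => simpa [kK, kKi] using h.neg.KKi i
  | KiK i => simpa [kK, kKi] using h.neg.KiK i
  | KE i j => simpa [kK, kE, QE] using h.pos.KiF hq' i j
  | KF i j => simpa [kK, kF, QE] using h.neg.KF i j
  | EF i j h1 h2 =>
    split_ifs with hij
    · subst hij; simpa [kE, kF, kK, kKi] using h.EF i h1 h2
    · simpa [kE, kF, sub_eq_zero] using h.EF_ne i j hij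
  | EE i j _ _ _ _ hij => simpa [kE] using h.pos.FF i j hij
  | FF i j _ _ _ _ hij => simpa [kF] using h.neg.FF i j hij
  | Eserre i j _ _ _ _ hij => simpa [kE, Tp] using h.pos.serre i j hij
  | Fserre i j _ _ _ _ hij => simpa [kF, Tp] using h.neg.serre i j hij

/-- The universal property of `U_q(gl(m))`. -/
noncomputable def UqRep.lift {q : ℝ} (hq : q ≠ 0) {m : ℕ} {K Ki E F : ℕ → A}
    (h : UqRep (q : ℂ) m K Ki E F) : Uq q m →ₐ[ℂ] A :=
  RingQuot.liftAlgHom ℂ ⟨freeLift K Ki E F, h.freeLift_rel hq⟩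

section

variable {q : ℝ} (hq : q ≠ 0) {m : ℕ} {K Ki E F : ℕ → A} (h : UqRep (q : ℂ) m K Ki E F)

theorem UqRep.lift_uK (i : ℕ) : h.lift hq (uK q m i) = K i := by
  simp [UqRep.lift, uK, freeLift, fK]

theorem UqRep.lift_uKi (i : ℕ) : h.lift hq (uKi q m i) = Ki i := by
  simp [UqRep.lift, uKi, freeLift, fKi]

theorem UqRep.lift_uE (i : ℕ) : h.lift hq (uE q m i) = E i := by
  simp [UqRep.lift, uE, freeLift, fE]

theorem UqRep.lift_uF (i : ℕ) : h.lift hq (uF q m i) = F i := by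
  simp [UqRep.lift, uF, freeLift, fF]

end

/-- The defining relations of the nonpositive part of `U_q(gl(m))`. -/
inductive NRel (q : ℂ) (m : ℕ) : AFA → AFA → Prop
  | Kout : ∀ i, ¬(1 ≤ i ∧ i ≤ m) → NRel q m (fγ i) 1
  | Kiout : ∀ i, ¬(1 ≤ i ∧ i ≤ m) → NRel q m (fγi i) 1
  | Fout : ∀ j, ¬(1 ≤ j ∧ j + 1 ≤ m) → NRel q m (fβ j) 0
  | KK : ∀ i j, NRel q m (fγ i * fγ j) (fγ j * fγ i)
  | KKi : ∀ i, NRel q m (fγ i * fγi i) 1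
  | KiK : ∀ i, NRel q m (fγi i * fγ i) 1
  | KF : ∀ i j, NRel q m (fγ i * fβ j) (q ^ (kd i (j + 1) - kd i j) • (fβ j * fγ i))
  | FF : ∀ i j, (i + 2 ≤ j ∨ j + 2 ≤ i) → NRel q m (fβ i * fβ j) (fβ j * fβ i)
  | serre : ∀ i j, (i + 1 = j ∨ j + 1 = i) → NRel q m (Tp 1 (q + q⁻¹) (fβ i) (fβ j)) 0

/-- The nonpositive part of `U_q(gl(m))`, by generators and relations. -/
abbrev Nq (q : ℂ) (m : ℕ) := RingQuot (NRel q m)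

noncomputable def nK (q : ℂ) (m i : ℕ) : Nq q m := RingQuot.mkAlgHom ℂ (NRel q m) (fγ i)
noncomputable def nKi (q : ℂ) (m i : ℕ) : Nq q m := RingQuot.mkAlgHom ℂ (NRel q m) (fγi i)
noncomputable def nF (q : ℂ) (m i : ℕ) : Nq q m := RingQuot.mkAlgHom ℂ (NRel q m) (fβ i)

theorem map_Tp (f : A →ₐ[ℂ] B) (p s : ℂ) (a b : A) : f (Tp p s a b) = Tp p s (f a) (f b) := by
  simp [Tp]

theorem borel_nq (q : ℂ) (m : ℕ) : Borel q m (nK q m) (nKi q m) (nF q m) := by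
  have rel : ∀ {x y}, NRel q m x y → RingQuot.mkAlgHom ℂ (NRel q m) x =
      RingQuot.mkAlgHom ℂ (NRel q m) y :=
    fun h => RingQuot.mkAlgHom_rel ℂ h
  exact
  { K_out := fun i hi => by simpa [nK] using rel (NRel.Kout i hi)
    Ki_out := fun i hi => by simpa [nKi] using rel (NRel.Kiout i hi)
    F_out := fun i hi => by simpa [nF] using rel (NRel.Fout i hi)
    KK := fun i j => by simpa [nK] using rel (NRel.KK i j)
    KKi := fun i => by simpa [nK, nKi] using rel (NRel.KKi i)
    KiK := fun i => by simpa [nK, nKi] using rel (NRel.KiK i)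
    KF := fun i j => by simpa [nK, nF, QE] using rel (NRel.KF i j)
    FF := fun i j hij => by simpa [nF] using rel (NRel.FF i j hij)
    serre := fun i j hij => by simpa [nF, map_Tp] using rel (NRel.serre i j hij) }

/-- The homomorphism out of the free algebra on `AGen` with prescribed values. -/
noncomputable def afaLift (K Ki F : ℕ → A) : AFA →ₐ[ℂ] A :=
  FreeAlgebra.lift ℂ fun
    | .g i => K i
    | .gi i => Ki i
    | .b i => F i

@[simp] theorem afaLift_fγ (K Ki F : ℕ → A) (i : ℕ) : afaLift K Ki F (fγ i) = K i := by
  simp [afaLift, fγ]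

@[simp] theorem afaLift_fγi (K Ki F : ℕ → A) (i : ℕ) : afaLift K Ki F (fγi i) = Ki i := by
  simp [afaLift, fγi]

@[simp] theorem afaLift_fβ (K Ki F : ℕ → A) (i : ℕ) : afaLift K Ki F (fβ i) = F i := by
  simp [afaLift, fβ]

theorem afa_hom_ext {f g : AFA →ₐ[ℂ] A} (hγ : ∀ i, f (fγ i) = g (fγ i))
    (hγi : ∀ i, f (fγi i) = g (fγi i)) (hβ : ∀ i, f (fβ i) = g (fβ i)) : f = g := by
  refine FreeAlgebra.hom_ext (funext fun x => ?_)
  cases x with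
  | g i => exact hγ i
  | gi i => exact hγi i
  | b i => exact hβ i

theorem Borel.afaLift_rel {q : ℂ} {m : ℕ} {K Ki F : ℕ → A} (h : Borel q m K Ki F)
    ⦃x y : AFA⦄ (hxy : NRel q m x y) : afaLift K Ki F x = afaLift K Ki F y := by
  cases hxy with
  | Kout i hi => simpa using h.K_out i hi
  | Kiout i hi => simpa using h.Ki_out i hi
  | Fout i hi => simpa using h.F_out i hi
  | KK i j => simpa using h.KK i j
  | KKi i => simpa using h.KKi i
  | KiK i => simpa using h.KiK i
  | KF i j => simpa [QE] using h.KF i j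
  | FF i j hij => simpa using h.FF i j hij
  | serre i j hij => simpa [map_Tp] using h.serre i j hij

/-- The universal property of the nonpositive part. -/
noncomputable def Borel.lift {q : ℂ} {m : ℕ} {K Ki F : ℕ → A} (h : Borel q m K Ki F) :
    Nq q m →ₐ[ℂ] A :=
  RingQuot.liftAlgHom ℂ ⟨afaLift K Ki F, h.afaLift_rel⟩

section

variable {q : ℂ} {m : ℕ} {K Ki F : ℕ → A} (h : Borel q m K Ki F)

theorem Borel.lift_nK (i : ℕ) : h.lift (nK q m i) = K i := by simp [Borel.lift, nK]

theorem Borel.lift_nKi (i : ℕ) : h.lift (nKi q m i) = Ki i := by simp [Borel.lift, nKi]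

theorem Borel.lift_nF (i : ℕ) : h.lift (nF q m i) = F i := by simp [Borel.lift, nF]

end

end Representations

section Coideal

variable {A : Type*} [Ring A] [Algebra ℂ A]

theorem QE.eq {q c : ℂ} {k : ℤ} {a b : A} (h : QE q k a b) (hc : q ^ k = c) :
    a * b = c • (b * a) := hc ▸ h

theorem Tp_smul (p s c d : ℂ) (a b : A) : Tp p s (c • a) (d • b) = (c ^ 2 * d) • Tp p s a b := by
  simp only [Tp, pow_two, smul_mul_assoc, mul_smul_comm, smul_smul]
  module

theorem Tp_smul_right (p s d : ℂ) (a b : A) : Tp p s a (d • b) = d • Tp p s a b := by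
  simpa using Tp_smul p s 1 d a b

theorem Tp_of_twisted_commute {p : ℂ} {a b : A} (h : a * b = p ^ 2 • (b * a)) :
    Tp p (p + p⁻¹) a b = 0 := by
  have h1 : a * b * a = p ^ 2 • (b * (a * a)) := by rw [h, smul_mul_assoc, mul_assoc]
  have h2 : a * a * b = (p ^ 2 * p ^ 2) • (b * (a * a)) := by
    rw [mul_assoc, h, mul_smul_comm, ← mul_assoc, h1, smul_smul]
  rw [Tp, pow_two, h2, h1]
  match_scalars; field_simp; ring

theorem commutator_of_opposite {q v : ℂ} {E F a b c : A} (hab : b * a = a * b)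
    (hac : c * a = a * c) (hbc : c * b = b * c) (hbE : b * E = q • (E * b))
    (haF : a * F = q • (F * a)) (hcE : c * E = E * c) (hcF : c * F = F * c)
    (hEF : (E * F - F * E) * (a * b) = v • (b * b - a * a)) :
    F * b * c * (c * E * a) - c * E * a * (F * b * c) = (q * v) • ((a * c) ^ 2 - (b * c) ^ 2) := by
  have l1 : F * b * c * (c * E * a) = q • (F * E * (a * b) * (c * c)) := by
    calc F * b * c * (c * E * a) = F * b * (c * (c * E)) * a := by simp only [mul_assoc]
      _ = F * (b * E) * (c * (c * a)) := by rw [hcE, ← mul_assoc c E c, hcE]; simp only [mul_assoc]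
      _ = q • (F * E * (b * a) * (c * c)) := by
        rw [hbE, hac, ← mul_assoc c a c, hac]; simp only [mul_assoc, mul_smul_comm, smul_mul_assoc]
      _ = _ := by rw [hab]
  have l2 : c * E * a * (F * b * c) = q • (E * F * (a * b) * (c * c)) := by
    calc c * E * a * (F * b * c) = c * E * (a * F) * b * c := by simp only [mul_assoc]
      _ = q • (E * (c * F) * a * b * c) := by
        rw [hcE, haF]; simp only [mul_assoc, mul_smul_comm, smul_mul_assoc]
      _ = q • (E * F * (c * a) * b * c) := by rw [hcF]; simp only [mul_assoc]
      _ = q • (E * F * a * (c * b) * c) := by rw [hac]; simp only [mul_assoc]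
      _ = _ := by rw [hbc]; simp only [mul_assoc]
  have l3 : (a * c) ^ 2 = a * a * (c * c) := by
    rw [pow_two, mul_assoc, ← mul_assoc c, hac]; simp only [mul_assoc]
  have l4 : (b * c) ^ 2 = b * b * (c * c) := by
    rw [pow_two, mul_assoc, ← mul_assoc c, hbc]; simp only [mul_assoc]
  have l5 : (F * E - E * F) * (a * b) = v • (a * a - b * b) := by
    rw [← neg_sub, neg_mul, hEF, ← smul_neg, neg_sub]
  rw [l1, l2, l3, l4, ← smul_sub, ← sub_mul, ← sub_mul, ← sub_mul, l5, smul_mul_assoc, smul_smul]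

theorem commutator_of_middle {q v : ℂ} (hq : q ≠ 0) {E F a b : A} (hab : b * a = a * b)
    (hbE : b * E = q • (E * b)) (haE : a * E = q⁻¹ • (E * a)) (haF : a * F = q • (F * a))
    (hEF : (E * F - F * E) * (a * b) = v • (b * b - a * a)) :
    F * b * a * (a * E * a) = (q ^ 2)⁻¹ • (a * E * a * (F * b * a)) + (-(q⁻¹ * v)) • (a * b) ^ 2
      + (q⁻¹ * v) • (a ^ 2 * a ^ 2) := by
  have l1 : F * b * a * (a * E * a) = q⁻¹ • (F * E * (a * b) * (a * a)) := by
    have : b * a * (a * E) = q⁻¹ • (E * (a * b) * a) := by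
      calc b * a * (a * E) = (q⁻¹ * q⁻¹) • (b * E * a * a) := by
            rw [mul_assoc b, haE, mul_smul_comm, ← mul_assoc a E, haE, smul_mul_assoc, smul_smul,
              mul_smul_comm]
            simp only [mul_assoc]
        _ = q⁻¹ • (E * (b * a) * a) := by
            rw [hbE]; simp only [mul_assoc, smul_mul_assoc, smul_smul]
            rw [inv_mul_cancel₀ hq, mul_one]
        _ = _ := by rw [hab]
    calc F * b * a * (a * E * a) = F * (b * a * (a * E)) * a := by simp only [mul_assoc]
      _ = _ := by rw [this]; simp only [mul_assoc, mul_smul_comm, smul_mul_assoc]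
  have l2 : a * E * a * (F * b * a) = q • (E * F * (a * b) * (a * a)) := by
    have : a * (a * F) = (q * q) • (F * (a * a)) := by
      rw [haF, mul_smul_comm, ← mul_assoc, haF, smul_mul_assoc, smul_smul, mul_assoc]
    calc a * E * a * (F * b * a) = q⁻¹ • (E * (a * (a * F)) * b * a) := by
          rw [haE]; simp only [mul_assoc, smul_mul_assoc]
      _ = q • (E * F * a * (a * b) * a) := by
          rw [this]; simp only [mul_assoc, mul_smul_comm, smul_mul_assoc, smul_smul]
          rw [inv_mul_cancel_left₀ hq]
      _ = q • (E * F * a * (b * a) * a) := by rw [hab]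
      _ = _ := by simp only [mul_assoc]
  have l3 : (a * b) ^ 2 = b * b * (a * a) := by
    rw [pow_two]; nth_rw 1 [← hab]
    rw [mul_assoc, ← hab, ← mul_assoc a b a, ← hab]; simp only [mul_assoc]
  have l4 : E * F * (a * b) * (a * a) = F * E * (a * b) * (a * a)
      + v • (b * b * (a * a)) - v • (a * a * (a * a)) := by
    rw [← sub_eq_zero]
    have := congrArg (· * (a * a)) hEF
    simp only [sub_mul, smul_mul_assoc, smul_sub] at this ⊢
    rw [add_sub_assoc, ← this]; abel
  rw [l1, l2, l3, l4]
  simp only [pow_two]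
  match_scalars <;> field_simp <;> ring

/-- The negative root part of the coideal generators. -/
def yPart (n : ℕ) (Ki F : ℕ → A) (j : ℕ) : A := F j * Ki (j + 1) * Ki (2 * n - j)

/-- The positive root part of the coideal generators. -/
def xPart (n : ℕ) (Ki E : ℕ → A) (j : ℕ) : A := Ki j * E (2 * n - j) * Ki (2 * n - j)

namespace Borel

variable {q : ℂ} {n : ℕ} {K Ki F : ℕ → A}

theorem yPart_out (h : Borel q (2 * n) K Ki F) {j : ℕ} (hj : ¬(1 ≤ j ∧ j + 1 ≤ 2 * n)) :
    yPart n Ki F j = 0 := by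
  rw [yPart, h.F_out j hj, zero_mul, zero_mul]

theorem Ki_yPart (h : Borel q (2 * n) K Ki F) (hq : q ≠ 0) (k j : ℕ) :
    QE q (kd k j - kd k (j + 1)) (Ki k) (yPart n Ki F j) :=
  (((h.KiF hq k j).mul_right hq (QE.of_comm (h.Ki_comm _ _))).mul_right hq
    (QE.of_comm (h.Ki_comm _ _))).congr (by ring)

theorem F_yPart (h : Borel q (2 * n) K Ki F) (hq : q ≠ 0) {i j : ℕ} (hij : i + 2 ≤ j ∨ j + 2 ≤ i) :
    QE q (-(kd (j + 1) i - kd (j + 1) (i + 1)) - (kd (2 * n - j) i - kd (2 * n - j) (i + 1)))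
      (F i) (yPart n Ki F j) :=
  (((QE.of_comm (h.FF i j hij)).mul_right hq ((h.KiF hq _ _).symm hq)).mul_right hq
    ((h.KiF hq _ _).symm hq)).congr (by ring)

theorem yPart_comm (h : Borel q (2 * n) K Ki F) (hq : q ≠ 0) {i j : ℕ}
    (hi : 1 ≤ i) (hi' : i + 1 ≤ 2 * n) (hj : 1 ≤ j) (hj' : j + 1 ≤ 2 * n)
    (hij : i + 2 ≤ j ∨ j + 2 ≤ i) : yPart n Ki F i * yPart n Ki F j =
      yPart n Ki F j * yPart n Ki F i := by
  have : QE q 0 (yPart n Ki F i) (yPart n Ki F j) :=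
    (((h.F_yPart hq hij).mul_left hq (h.Ki_yPart hq _ _)).mul_left hq (h.Ki_yPart hq _ _)).congr (by
      simp only [kd]; split_ifs <;> omega)
  simpa [QE] using this

theorem Tp_yPart (h : Borel q (2 * n) K Ki F) (hq : q ≠ 0) {i j : ℕ} {e : ℤ}
    (hi : 1 ≤ i) (hi' : i + 1 ≤ 2 * n) (hj : 1 ≤ j) (hj' : j + 1 ≤ 2 * n)
    (hij : i + 1 = j ∧ e = 1 ∨ j + 1 = i ∧ e = -1) :
    Tp (q ^ e) (q + q⁻¹) (yPart n Ki F i) (yPart n Ki F j) = 0 := by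
  have W : ∀ a b, QE q (kd (a + 1) b - kd (a + 1) (b + 1) +
      (kd (2 * n - a) b - kd (2 * n - a) (b + 1)))
      (Ki (a + 1) * Ki (2 * n - a)) (F b) := fun a b =>
    (h.KiF hq _ _).mul_left hq (h.KiF hq _ _)
  have hc : ∀ a b c d : ℕ, Ki a * Ki b * (Ki c * Ki d) = Ki c * Ki d * (Ki a * Ki b) :=
      fun a b c d => by
    have : QE q (0 + 0) (Ki a * Ki b) (Ki c * Ki d) := by
      refine QE.mul_left hq ?_ ?_ <;>
      exact (QE.mul_right hq (QE.of_comm (h.Ki_comm _ _)) (QE.of_comm (h.Ki_comm _ _))).congr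
        (by ring)
    simpa [QE] using this
  simp only [yPart, mul_assoc]
  refine Tp_twist (h.serre i j (by omega)) (W i i) (W i j) (W j i) (hc _ _ _ _) one_ne_zero
    (zpow_ne_zero _ hq) ?_
  rw [mul_one, ← zpow_add₀ hq]
  congr 1
  simp only [kd]; split_ifs <;> omega

end Borel

namespace UqRep

variable {q : ℂ} {n : ℕ} {K Ki E F : ℕ → A}

theorem Ki_E (h : UqRep q (2 * n) K Ki E F) (k j : ℕ) :
    QE q (kd k (j + 1) - kd k j) (Ki k) (E j) := h.pos.KF k j

theorem xPart_eq (h : UqRep q (2 * n) K Ki E F) (j : ℕ) :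
    xPart n Ki E j = q ^ (kd j (2 * n - j + 1) - kd j (2 * n - j)) •
      (E (2 * n - j) * (Ki j * Ki (2 * n - j))) := by
  rw [xPart, show Ki j * E (2 * n - j) = _ from h.Ki_E _ _, smul_mul_assoc, mul_assoc]

theorem Ki_xPart (h : UqRep q (2 * n) K Ki E F) (hq : q ≠ 0) (k j : ℕ) :
    QE q (kd k (2 * n - j + 1) - kd k (2 * n - j)) (Ki k) (xPart n Ki E j) :=
  (((QE.of_comm (h.neg.Ki_comm _ _)).mul_right hq (h.Ki_E _ _)).mul_right hq
    (QE.of_comm (h.neg.Ki_comm _ _))).congr (by ring)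

theorem F_xPart (h : UqRep q (2 * n) K Ki E F) (hq : q ≠ 0) {i j : ℕ} (hij : 2 * n - j ≠ i) :
    QE q (-(kd j i - kd j (i + 1)) - (kd (2 * n - j) i - kd (2 * n - j) (i + 1)))
      (F i) (xPart n Ki E j) :=
  ((((h.neg.KiF hq _ _).symm hq).mul_right hq (QE.of_comm (h.EF_ne _ _ hij).symm)).mul_right hq
    ((h.neg.KiF hq _ _).symm hq)).congr (by ring)

theorem yPart_xPart (h : UqRep q (2 * n) K Ki E F) (hq : q ≠ 0) {i j : ℕ} (hij : 2 * n - j ≠ i) :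
    QE q (-(kd j i - kd j (i + 1)) - (kd (2 * n - j) i - kd (2 * n - j) (i + 1))
      + (kd (i + 1) (2 * n - j + 1) - kd (i + 1) (2 * n - j))
      + (kd (2 * n - i) (2 * n - j + 1) - kd (2 * n - i) (2 * n - j)))
      (yPart n Ki F i) (xPart n Ki E j) :=
  ((h.F_xPart hq hij).mul_left hq (h.Ki_xPart hq _ _)).mul_left hq (h.Ki_xPart hq _ _)

theorem E_xPart (h : UqRep q (2 * n) K Ki E F) (hq : q ≠ 0) {i j : ℕ}
    (hij : 2 * n - i + 2 ≤ 2 * n - j ∨ 2 * n - j + 2 ≤ 2 * n - i) :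
    QE q (-(kd j (2 * n - i + 1) - kd j (2 * n - i))
      - (kd (2 * n - j) (2 * n - i + 1) - kd (2 * n - j) (2 * n - i)))
      (E (2 * n - i)) (xPart n Ki E j) :=
  ((((h.Ki_E _ _).symm hq).mul_right hq (QE.of_comm (h.pos.FF _ _ hij))).mul_right hq
    ((h.Ki_E _ _).symm hq)).congr (by ring)

theorem xPart_comm (h : UqRep q (2 * n) K Ki E F) (hq : q ≠ 0) {i j : ℕ}
    (hi' : i + 1 ≤ 2 * n) (hj' : j + 1 ≤ 2 * n)
    (hij : i + 2 ≤ j ∨ j + 2 ≤ i) : xPart n Ki E i * xPart n Ki E j =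
      xPart n Ki E j * xPart n Ki E i := by
  have : QE q 0 (xPart n Ki E i) (xPart n Ki E j) :=
    (((h.Ki_xPart hq _ _).mul_left hq (h.E_xPart hq (by omega))).mul_left hq
      (h.Ki_xPart hq _ _)).congr (by
      simp only [kd]; split_ifs <;> omega)
  simpa [QE] using this

theorem Tp_xPart (h : UqRep q (2 * n) K Ki E F) (hq : q ≠ 0) {i j : ℕ} {e : ℤ}
    (hi : 1 ≤ i) (hi' : i + 1 ≤ 2 * n) (hj' : j + 1 ≤ 2 * n)
    (hij : i + 1 = j ∧ e = 1 ∨ j + 1 = i ∧ e = -1) :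
    Tp (q ^ e) (q + q⁻¹) (xPart n Ki E i) (xPart n Ki E j) = 0 := by
  have W : ∀ a b, QE q (kd a (b + 1) - kd a b + (kd (2 * n - a) (b + 1) - kd (2 * n - a) b))
      (Ki a * Ki (2 * n - a)) (E b) := fun a b =>
    (h.Ki_E _ _).mul_left hq (h.Ki_E _ _)
  have hc : ∀ a b c d : ℕ, Ki a * Ki b * (Ki c * Ki d) = Ki c * Ki d * (Ki a * Ki b) :=
      fun a b c d => by
    have : QE q (0 + 0) (Ki a * Ki b) (Ki c * Ki d) := by
      refine QE.mul_left hq ?_ ?_ <;>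
      exact (QE.mul_right hq (QE.of_comm (h.neg.Ki_comm _ _))
        (QE.of_comm (h.neg.Ki_comm _ _))).congr
        (by ring)
    simpa [QE] using this
  rw [h.xPart_eq, h.xPart_eq, Tp_smul,
    Tp_twist (h.pos.serre _ _ (by omega)) (W i _) (W i _) (W j _) (hc _ _ _ _) one_ne_zero
    (zpow_ne_zero _ hq), smul_zero]
  rw [mul_one, ← zpow_add₀ hq]
  congr 1
  simp only [kd]; split_ifs <;> omega

theorem EF_mul (h : UqRep q (2 * n) K Ki E F) {i : ℕ} (h1 : 1 ≤ i) (h2 : i + 1 ≤ 2 * n) :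
    (E i * F i - F i * E i) * (Ki i * Ki (i + 1)) =
      (q - q⁻¹)⁻¹ • (Ki (i + 1) * Ki (i + 1) - Ki i * Ki i) := by
  rw [h.EF i h1 h2, smul_mul_assoc, sub_mul]
  congr 2
  · rw [h.neg.K_comm_Ki, mul_assoc, ← mul_assoc (K i), h.neg.KKi, one_mul]
  · rw [h.neg.Ki_comm i, mul_assoc, ← mul_assoc (K _), h.neg.KKi, one_mul]

theorem yPart_xPart_middle (h : UqRep q (2 * n) K Ki E F) (hq : q ≠ 0) (hn : 1 ≤ n) :
    yPart n Ki F n * xPart n Ki E n = (q ^ 2)⁻¹ • (xPart n Ki E n * yPart n Ki F n)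
      + (-(q⁻¹ * (q - q⁻¹)⁻¹)) • (Ki n * Ki (n + 1)) ^ 2
      + (q⁻¹ * (q - q⁻¹)⁻¹) • (Ki n ^ 2 * Ki n ^ 2) := by
  have e : 2 * n - n = n := by omega
  simp only [yPart, xPart, e]
  exact commutator_of_middle hq (h.neg.Ki_comm _ _) ((h.Ki_E _ _).eq (by simp [kd]))
    ((h.Ki_E _ _).eq (by simp [kd])) ((h.neg.KiF hq _ _).eq (by simp [kd]))
    (h.EF_mul hn (by omega))

theorem yPart_xPart_opposite (h : UqRep q (2 * n) K Ki E F) (hq : q ≠ 0) {i j : ℕ}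
    (hi : 1 ≤ i) (hj : 1 ≤ j) (hij : i + j = 2 * n) (hne : i + 2 ≤ j ∨ j + 2 ≤ i) :
    yPart n Ki F i * xPart n Ki E j - xPart n Ki E j * yPart n Ki F i =
      (q * (q - q⁻¹)⁻¹) • ((Ki i * Ki j) ^ 2 - (Ki (i + 1) * Ki j) ^ 2) := by
  have e1 : 2 * n - i = j := by omega
  have e2 : 2 * n - j = i := by omega
  simp only [yPart, xPart, e1, e2]
  refine commutator_of_opposite (h.neg.Ki_comm _ _) (h.neg.Ki_comm _ _) (h.neg.Ki_comm _ _)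
    ((h.Ki_E _ _).eq (by simp [kd])) ((h.neg.KiF hq _ _).eq (by simp [kd])) ?_ ?_
    (h.EF_mul hi (by omega))
  · have := (h.Ki_E j i).congr (l := 0) (by simp only [kd]; split_ifs <;> omega)
    simpa [QE] using this
  · have := (h.neg.KiF hq j i).congr (l := 0) (by simp only [kd]; split_ifs <;> omega)
    simpa [QE] using this

end UqRep

theorem Tp_sum_sum {p u w t : ℂ} {P M k g P' M' : A} (hp : p ≠ 0)
    (hPP' : Tp p (p + p⁻¹) P P' = 0) (hMP' : M * P' = P' * M)
    (hMM' : Tp p (p + p⁻¹) M M' = 0) (hPM' : P * M' = p ^ 2 • (M' * P))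
    (hPM : P * M = (p ^ 2)⁻¹ • (M * P) + u • g + w • (k * k))
    (hkP' : k * P' = P' * k) (hgP' : g * P' = p ^ 2 • (P' * g))
    (hkM' : k * M' = p ^ 2 • (M' * k)) (hgM' : g * M' = p ^ 2 • (M' * g))
    (hkP : k * P = p ^ 2 • (P * k)) (hkM : k * M = (p ^ 2)⁻¹ • (M * k)) :
    Tp p (p + p⁻¹) (P + M + t • k) (P' + M') = (p * (1 - p ^ 2) * u) • ((P' + M') * g) := by
  have hMP : M * P = p ^ 2 • (P * M) + (-(p ^ 2 * u)) • g + (-(p ^ 2 * w)) • (k * k) := by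
    rw [hPM]; match_scalars <;> field_simp <;> ring
  rw [Tp_add_right, Tp_sum_of_commute hp hPP' hMP' hPM hkP' hgP' hkP hkM, add_comm P M,
    Tp_sum_of_twisted_commute hp hMM' hPM' hMP hkM' hgM' hkM hkP, add_mul, smul_add]
  congr 2
  field_simp
  ring

theorem zpow_eq_of_eq {q : ℂ} {e e' : ℤ} {c : ℂ} (h : e = e') (hc : q ^ e' = c) : q ^ e = c :=
    h ▸ hc

/-- The generators of the coideal subalgebra with parameter `t`. -/
noncomputable def bGen (n : ℕ) (Ki E F : ℕ → A) (t : ℂ) (j : ℕ) : A :=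
  yPart n Ki F j + xPart n Ki E j + (if j = n then t else 0) • Ki n ^ 2

namespace UqRep

variable {q : ℂ} {n : ℕ} {K Ki E F : ℕ → A} {t : ℂ}

theorem yPart_xPart_up (h : UqRep q (2 * n) K Ki E F) (hq : q ≠ 0) {i : ℕ} (h1 : 1 ≤ i)
    (h2 : i + 2 ≤ 2 * n) : yPart n Ki F i * xPart n Ki E (i + 1) =
      q ^ 2 • (xPart n Ki E (i + 1) * yPart n Ki F i) := by
  refine QE.eq ((h.yPart_xPart hq (by omega)).congr (l := 2) ?_) (by norm_cast)
  simp only [kd]; split_ifs <;> omega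

theorem yPart_xPart_down (h : UqRep q (2 * n) K Ki E F) (hq : q ≠ 0) {i : ℕ} (h1 : 1 ≤ i)
    (h2 : i + 2 ≤ 2 * n) : yPart n Ki F (i + 1) * xPart n Ki E i =
      xPart n Ki E i * yPart n Ki F (i + 1) := by
  have := (h.yPart_xPart hq (show 2 * n - i ≠ i + 1 by omega)).congr (l := 0)
    (by simp only [kd]; split_ifs <;> omega)
  simpa [QE] using this

theorem yPart_xPart_self (h : UqRep q (2 * n) K Ki E F) (hq : q ≠ 0) {i : ℕ}
    (h2 : i + 1 ≤ 2 * n) (hi : i ≠ n) : yPart n Ki F i * xPart n Ki E i =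
      (q ^ 2)⁻¹ • (xPart n Ki E i * yPart n Ki F i) := by
  refine QE.eq ((h.yPart_xPart hq (by omega)).congr (l := -2) ?_) (by simp [zpow_neg])
  simp only [kd]; split_ifs <;> omega

theorem yPart_xPart_far (h : UqRep q (2 * n) K Ki E F) (hq : q ≠ 0) {i j : ℕ} (h1 : 1 ≤ i)
    (h2 : i + 1 ≤ 2 * n) (h4 : j + 1 ≤ 2 * n) (hij : i + 2 ≤ j ∨ j + 2 ≤ i)
    (hs : i + j ≠ 2 * n) : yPart n Ki F i * xPart n Ki E j =
      xPart n Ki E j * yPart n Ki F i := by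
  have := (h.yPart_xPart hq (show 2 * n - j ≠ i by omega)).congr (l := 0)
    (by simp only [kd]; split_ifs <;> omega)
  simpa [QE] using this

theorem Ki_sq_yPart (h : UqRep q (2 * n) K Ki E F) (hq : q ≠ 0) {j : ℕ} {c : ℂ}
    (hc : q ^ (2 * (kd n j - kd n (j + 1))) = c) :
    Ki n ^ 2 * yPart n Ki F j = c • (yPart n Ki F j * Ki n ^ 2) := by
  rw [pow_two]
  exact QE.eq ((h.neg.Ki_yPart hq _ _).mul_left hq (h.neg.Ki_yPart hq _ _))
    (by rw [← hc]; congr 1; ring)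

theorem Ki_sq_xPart (h : UqRep q (2 * n) K Ki E F) (hq : q ≠ 0) {j : ℕ} {c : ℂ}
    (hc : q ^ (2 * (kd n (2 * n - j + 1) - kd n (2 * n - j))) = c) :
    Ki n ^ 2 * xPart n Ki E j = c • (xPart n Ki E j * Ki n ^ 2) := by
  rw [pow_two]
  exact QE.eq ((h.Ki_xPart hq _ _).mul_left hq (h.Ki_xPart hq _ _)) (by rw [← hc]; congr 1; ring)

theorem KiKi_sq_yPart (h : UqRep q (2 * n) K Ki E F) (hq : q ≠ 0) {j : ℕ} {c : ℂ}
    (hc : q ^ (2 * (kd n j - kd n (j + 1) + (kd (n + 1) j - kd (n + 1) (j + 1)))) = c) :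
    (Ki n * Ki (n + 1)) ^ 2 * yPart n Ki F j = c • (yPart n Ki F j * (Ki n * Ki (n + 1)) ^ 2) := by
  rw [pow_two]
  have := (h.neg.Ki_yPart hq n j).mul_left hq (h.neg.Ki_yPart hq (n + 1) j)
  exact QE.eq (this.mul_left hq this) (by rw [← hc]; congr 1; ring)

theorem KiKi_sq_xPart (h : UqRep q (2 * n) K Ki E F) (hq : q ≠ 0) {j : ℕ} {c : ℂ}
    (hc : q ^ (2 * (kd n (2 * n - j + 1) - kd n (2 * n - j)
      + (kd (n + 1) (2 * n - j + 1) - kd (n + 1) (2 * n - j)))) = c) :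
    (Ki n * Ki (n + 1)) ^ 2 * xPart n Ki E j = c • (xPart n Ki E j * (Ki n * Ki (n + 1)) ^ 2) := by
  rw [pow_two]
  have := (h.Ki_xPart hq n j).mul_left hq (h.Ki_xPart hq (n + 1) j)
  exact QE.eq (this.mul_left hq this) (by rw [← hc]; congr 1; ring)

theorem bGen_serre_up (h : UqRep q (2 * n) K Ki E F) (hq : q ≠ 0) (hq2 : q ^ 2 - 1 ≠ 0) {i : ℕ}
    (h1 : 1 ≤ i) (h2 : i + 2 ≤ 2 * n) :
    Tp q (q + q⁻¹) (bGen n Ki E F t i) (bGen n Ki E F t (i + 1)) =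
      if i = n then q • (bGen n Ki E F t (i + 1) * (Ki n * Ki (n + 1)) ^ 2) else 0 := by
  have two : q ^ (2 : ℤ) = q ^ 2 := by norm_cast
  have ntwo : q ^ (-2 : ℤ) = (q ^ 2)⁻¹ := by rw [zpow_neg, two]
  have hY : Tp q (q + q⁻¹) (yPart n Ki F i) (yPart n Ki F (i + 1)) = 0 := by
    simpa using h.neg.Tp_yPart hq (i := i) (j := i + 1) (e := 1) h1 (by omega) (by omega) h2
      (by omega)
  have hX : Tp q (q + q⁻¹) (xPart n Ki E i) (xPart n Ki E (i + 1)) = 0 := by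
    simpa using h.Tp_xPart hq (i := i) (j := i + 1) (e := 1) h1 (by omega) h2 (by omega)
  split_ifs with hi
  · subst hi
    have e : bGen i Ki E F t (i + 1) = yPart i Ki F (i + 1) + xPart i Ki E (i + 1) := by simp [bGen]
    have e' : bGen i Ki E F t i = yPart i Ki F i + xPart i Ki E i + t • Ki i ^ 2 := by simp [bGen]
    rw [e, e']
    rw [Tp_sum_sum hq hY (h.yPart_xPart_down hq h1 h2).symm hX (h.yPart_xPart_up hq h1 h2)
      (h.yPart_xPart_middle hq h1)]
    · congr 1
      field_simp
      ring
    · simpa using h.Ki_sq_yPart hq (c := 1)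
          (zpow_eq_of_eq (e' := 0) (by simp only [kd]; split_ifs <;> omega) (by simp))
    · exact h.KiKi_sq_yPart hq (zpow_eq_of_eq (by simp only [kd]; split_ifs <;> omega) two)
    · exact h.Ki_sq_xPart hq (zpow_eq_of_eq (by simp only [kd]; split_ifs <;> omega) two)
    · exact h.KiKi_sq_xPart hq (zpow_eq_of_eq (by simp only [kd]; split_ifs <;> omega) two)
    · exact h.Ki_sq_yPart hq (zpow_eq_of_eq (by simp only [kd]; split_ifs <;> omega) two)
    · exact h.Ki_sq_xPart hq (zpow_eq_of_eq (by simp only [kd]; split_ifs <;> omega) ntwo)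
  · have e' : bGen n Ki E F t i = yPart n Ki F i + xPart n Ki E i + (0 : ℂ) • (0 : A) := by
      simp [bGen, hi]
    have hs : yPart n Ki F i * xPart n Ki E i = (q ^ 2)⁻¹ • (xPart n Ki E i * yPart n Ki F i)
        + (0 : ℂ) • (0 : A) + (0 : ℂ) • ((0 : A) * 0) := by
      simpa using h.yPart_xPart_self hq (by omega) hi
    rw [e', bGen, Tp_add_right, Tp_smul_right,
      Tp_sum_sum hq hY (h.yPart_xPart_down hq h1 h2).symm hX
      (h.yPart_xPart_up hq h1 h2) hs (by simp) (by simp) (by simp) (by simp) (by simp) (by simp)]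
    by_cases hn : i + 1 = n
    · rw [Tp_sum_of_commute hq (Tp_of_twisted_commute ?_) ?_ hs (by simp) (by simp) (by simp)
          (by simp)]
      · simp
      · have := h.Ki_sq_yPart hq (j := i) (c := (q ^ 2)⁻¹)
          (zpow_eq_of_eq (by simp only [kd]; split_ifs <;> omega) ntwo)
        rw [this, smul_smul, mul_inv_cancel₀ (by positivity), one_smul]
      · have := h.Ki_sq_xPart hq (j := i) (c := 1)
          (zpow_eq_of_eq (e' := 0) (by simp only [kd]; split_ifs <;> omega) (by simp))
        rw [this, one_smul]
    · simp [hn]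

theorem bGen_serre_down (h : UqRep q (2 * n) K Ki E F) (hq : q ≠ 0) (hq2 : q ^ 2 - 1 ≠ 0) {i : ℕ}
    (h1 : 1 ≤ i) (h2 : i + 2 ≤ 2 * n) :
    Tp q⁻¹ (q + q⁻¹) (bGen n Ki E F t (i + 1)) (bGen n Ki E F t i) =
      if i + 1 = n then q⁻¹ • (bGen n Ki E F t i * (Ki n * Ki (n + 1)) ^ 2) else 0 := by
  have hq' : q⁻¹ ≠ 0 := inv_ne_zero hq
  have hs : q + q⁻¹ = q⁻¹ + q⁻¹⁻¹ := by rw [inv_inv, add_comm]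
  have two : q ^ (2 : ℤ) = (q⁻¹ ^ 2)⁻¹ := by simp
  have ntwo : q ^ (-2 : ℤ) = q⁻¹ ^ 2 := by simp [zpow_neg]
  have hY : Tp q⁻¹ (q⁻¹ + q⁻¹⁻¹) (yPart n Ki F (i + 1)) (yPart n Ki F i) = 0 := by
    rw [← hs]
    simpa using h.neg.Tp_yPart hq (i := i + 1) (j := i) (e := -1) (by omega) (by omega) h1
      (by omega) (by omega)
  have hX : Tp q⁻¹ (q⁻¹ + q⁻¹⁻¹) (xPart n Ki E (i + 1)) (xPart n Ki E i) = 0 := by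
    rw [← hs]
    simpa using h.Tp_xPart hq (i := i + 1) (j := i) (e := -1) (by omega) (by omega) (by omega)
      (by omega)
  have hXY : xPart n Ki E (i + 1) * yPart n Ki F i =
      q⁻¹ ^ 2 • (yPart n Ki F i * xPart n Ki E (i + 1)) := by
    rw [h.yPart_xPart_up hq h1 h2, smul_smul, inv_pow, inv_mul_cancel₀ (by positivity), one_smul]
  rw [hs]
  split_ifs with hi
  · subst hi
    set m := i + 1 with hm
    have e : bGen m Ki E F t i = xPart m Ki E i + yPart m Ki F i := by
      simp [bGen, hm, add_comm]
    have e' : bGen m Ki E F t m = xPart m Ki E m + yPart m Ki F m + t • Ki m ^ 2 := by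
      simp [bGen, add_comm (xPart m Ki E m)]
    have hmid : xPart m Ki E m * yPart m Ki F m = (q⁻¹ ^ 2)⁻¹ • (yPart m Ki F m * xPart m Ki E m)
        + (q * (q - q⁻¹)⁻¹) • (Ki m * Ki (m + 1)) ^ 2 +
          (-(q * (q - q⁻¹)⁻¹)) • (Ki m ^ 2 * Ki m ^ 2) := by
      rw [h.yPart_xPart_middle hq (by omega)]
      match_scalars <;> field_simp <;> ring
    rw [e, e']
    rw [Tp_sum_sum hq' hX (h.yPart_xPart_down hq h1 h2) hY hXY hmid]
    · congr 1
      field_simp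
    · simpa using h.Ki_sq_xPart hq (c := 1)
          (zpow_eq_of_eq (e' := 0) (by simp only [kd]; split_ifs <;> omega) (by simp))
    · exact h.KiKi_sq_xPart hq (zpow_eq_of_eq (by simp only [kd]; split_ifs <;> omega) ntwo)
    · exact h.Ki_sq_yPart hq (zpow_eq_of_eq (by simp only [kd]; split_ifs <;> omega) ntwo)
    · exact h.KiKi_sq_yPart hq (zpow_eq_of_eq (by simp only [kd]; split_ifs <;> omega) ntwo)
    · exact h.Ki_sq_xPart hq (zpow_eq_of_eq (by simp only [kd]; split_ifs <;> omega) ntwo)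
    · exact h.Ki_sq_yPart hq (zpow_eq_of_eq (by simp only [kd]; split_ifs <;> omega) two)
  · have e' : bGen n Ki E F t (i + 1) = xPart n Ki E (i + 1) + yPart n Ki F (i + 1) +
        (0 : ℂ) • (0 : A) := by
      simp [bGen, hi, add_comm]
    have hself : xPart n Ki E (i + 1) * yPart n Ki F (i + 1) =
        (q⁻¹ ^ 2)⁻¹ • (yPart n Ki F (i + 1) * xPart n Ki E (i + 1))
        + (0 : ℂ) • (0 : A) + (0 : ℂ) • ((0 : A) * 0) := by
      rw [h.yPart_xPart_self hq h2 hi, smul_smul, inv_pow, inv_inv,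
        mul_inv_cancel₀ (by positivity)]
      simp
    rw [e', bGen, Tp_add_right, Tp_smul_right, add_comm (yPart n Ki F i),
      Tp_sum_sum hq' hX (h.yPart_xPart_down hq h1 h2) hY
      hXY hself (by simp) (by simp) (by simp) (by simp) (by simp) (by simp)]
    by_cases hn : i = n
    · rw [Tp_sum_of_commute hq' (Tp_of_twisted_commute ?_) ?_ hself (by simp) (by simp) (by simp)
          (by simp)]
      · simp
      · have := h.Ki_sq_xPart hq (j := i + 1) (c := (q⁻¹ ^ 2)⁻¹)
          (zpow_eq_of_eq (by simp only [kd]; split_ifs <;> omega) two)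
        rw [this, smul_smul, mul_inv_cancel₀ (by positivity), one_smul]
      · have := h.Ki_sq_yPart hq (j := i + 1) (c := 1)
          (zpow_eq_of_eq (e' := 0) (by simp only [kd]; split_ifs <;> omega) (by simp))
        rw [this, one_smul]
    · simp [hn]

theorem bGen_comm (h : UqRep q (2 * n) K Ki E F) (hq : q ≠ 0) {i j : ℕ} (h1 : 1 ≤ i)
    (h2 : i + 1 ≤ 2 * n) (h3 : 1 ≤ j) (h4 : j + 1 ≤ 2 * n) (hij : i + 2 ≤ j ∨ j + 2 ≤ i) :
    bGen n Ki E F t i * bGen n Ki E F t j - bGen n Ki E F t j * bGen n Ki E F t i =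
      if i + j = 2 * n then (q * (q - q⁻¹)⁻¹) •
        ((Ki i * Ki (2 * n + 1 - i)) ^ 2 - (Ki (i + 1) * Ki (2 * n - i)) ^ 2) else 0 := by
  have hYY := h.neg.yPart_comm hq h1 h2 h3 h4 hij
  have hXX := h.xPart_comm hq h2 h4 hij
  split_ifs with hs
  · have e1 : 2 * n + 1 - i = j + 1 := by omega
    have e2 : 2 * n - i = j := by omega
    have hYX := h.yPart_xPart_opposite hq h1 h3 hs hij
    have hXY := h.yPart_xPart_opposite hq h3 h1 (by omega) hij.symm
    rw [e1, e2, bGen, bGen, if_neg (by omega), if_neg (by omega), zero_smul, add_zero, add_zero,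
      h.neg.Ki_comm i (j + 1)]
    rw [h.neg.Ki_comm j i] at hXY
    calc _ = (yPart n Ki F i * xPart n Ki E j - xPart n Ki E j * yPart n Ki F i)
          - (yPart n Ki F j * xPart n Ki E i - xPart n Ki E i * yPart n Ki F j) := by
          simp only [mul_add, add_mul, hYY, hXX]; abel
      _ = _ := by rw [hYX, hXY]; module
  · have hYX := h.yPart_xPart_far hq h1 h2 h4 hij hs
    have hXY := h.yPart_xPart_far hq h3 h4 h2 hij.symm (by omega)
    have hZ : ∀ k, n + 2 ≤ k ∨ k + 2 ≤ n → 1 ≤ k → k + 1 ≤ 2 * n →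
        Ki n ^ 2 * yPart n Ki F k = yPart n Ki F k * Ki n ^ 2 ∧
        Ki n ^ 2 * xPart n Ki E k = xPart n Ki E k * Ki n ^ 2 := fun k hk _ _ => by
      constructor
      · simpa using h.Ki_sq_yPart hq (c := 1)
          (zpow_eq_of_eq (e' := 0) (by simp only [kd]; split_ifs <;> omega) (by simp))
      · simpa using h.Ki_sq_xPart hq (c := 1)
          (zpow_eq_of_eq (e' := 0) (by simp only [kd]; split_ifs <;> omega) (by simp))
    rw [sub_eq_zero]
    by_cases hi : i = n
    · subst hi
      obtain ⟨z1, z2⟩ := hZ j hij h3 h4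
      simp only [bGen, if_neg (show j ≠ i by omega), if_true, zero_smul, add_zero, mul_add, add_mul,
        smul_mul_assoc, mul_smul_comm, smul_add, z1, z2, hYY, hXX, hYX, hXY]
      abel
    · by_cases hj : j = n
      · subst hj
        obtain ⟨z1, z2⟩ := hZ i hij.symm h1 h2
        simp only [bGen, if_neg hi, if_true, zero_smul, add_zero, mul_add, add_mul,
          smul_mul_assoc, mul_smul_comm, smul_add, z1, z2, hYY, hXX, hYX, hXY]
        abel
      · simp only [bGen, if_neg hi, if_neg hj, zero_smul, add_zero, mul_add, add_mul,
          hYY, hXX, hYX, hXY]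
        abel

theorem KK_bGen (h : UqRep q (2 * n) K Ki E F) (hq : q ≠ 0) {i j : ℕ} (h1 : 1 ≤ i)
    (h2 : i ≤ 2 * n) (h4 : j + 1 ≤ 2 * n) :
    QE q (-(gex n i j)) (K i * K (2 * n + 1 - i)) (bGen n Ki E F t j) := by
  have hY : QE q (-(gex n i j)) (K i * K (2 * n + 1 - i)) (yPart n Ki F j) := by
    have hK : ∀ k, QE q (kd k (j + 1) - kd k j) (K k) (yPart n Ki F j) := fun k =>
      ((h.neg.Ki_yPart hq k j).inv_left hq (h.neg.KiK k) (h.neg.KKi k)).congr (by ring)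
    exact ((hK _).mul_left hq (hK _)).congr (by rw [gex]; ring)
  have hX : QE q (-(gex n i j)) (K i * K (2 * n + 1 - i)) (xPart n Ki E j) := by
    have hK : ∀ k, QE q (-(kd k (2 * n - j + 1) - kd k (2 * n - j))) (K k) (xPart n Ki E j) :=
      fun k => (h.Ki_xPart hq k j).inv_left hq (h.neg.KiK k) (h.neg.KKi k)
    refine ((hK _).mul_left hq (hK _)).congr ?_
    simp only [gex, kd]; split_ifs <;> omega
  have hZ : K i * K (2 * n + 1 - i) * Ki n ^ 2 = Ki n ^ 2 * (K i * K (2 * n + 1 - i)) := by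
    have c : ∀ k, QE q 0 (K k) (Ki n ^ 2) := fun k => by
      rw [pow_two]
      exact (QE.of_comm (h.neg.K_comm_Ki _ _)).mul_right hq (QE.of_comm (h.neg.K_comm_Ki _ _))
    simpa [QE] using (c i).mul_left hq (c (2 * n + 1 - i))
  unfold QE at *
  by_cases hj : j = n
  · subst hj
    have e : gex j i j = 0 := by simp only [gex, kd]; split_ifs <;> omega
    rw [e, neg_zero, zpow_zero, one_smul] at hY hX ⊢
    simp only [bGen, if_true, mul_add, add_mul, hY, hX, mul_smul_comm, hZ, smul_mul_assoc]
  · simp only [bGen, if_neg hj, zero_smul, add_zero, mul_add, add_mul, hY, hX, smul_add]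

theorem bGen_out (h : UqRep q (2 * n) K Ki E F) (hn : 1 ≤ n) {j : ℕ}
    (hj : ¬(1 ≤ j ∧ j + 1 ≤ 2 * n)) : bGen n Ki E F t j = 0 := by
  rw [bGen, h.neg.yPart_out hj, xPart, h.pos.F_out _ (by omega), if_neg (by omega)]
  simp

theorem coideal_rel {q : ℝ} (h : UqRep (q : ℂ) (2 * n) K Ki E F) (hn : 1 ≤ n) (hq : (q : ℂ) ≠ 0)
    (hq2 : (q : ℂ) ^ 2 - 1 ≠ 0) ⦃x y : AFA⦄ (hxy : ARel q n x y) :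
    afaLift (fun i => K i * K (2 * n + 1 - i)) (fun i => Ki i * Ki (2 * n + 1 - i))
      (bGen n Ki E F t) x =
    afaLift (fun i => K i * K (2 * n + 1 - i)) (fun i => Ki i * Ki (2 * n + 1 - i))
      (bGen n Ki E F t) y := by
  have en : 2 * n + 1 - n = n + 1 := by omega
  have KiK' : ∀ a b, Ki a * Ki b * (K a * K b) = 1 := fun a b => by
    rw [h.neg.Ki_comm a b, mul_assoc, ← mul_assoc (Ki a), h.neg.KiK, one_mul, h.neg.KiK]
  have KKi' : ∀ a b, K a * K b * (Ki a * Ki b) = 1 := fun a b => by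
    rw [h.neg.KK a b, mul_assoc, ← mul_assoc (K a), h.neg.KKi, one_mul, h.neg.KKi]
  cases hxy with
  | gout i hi => simp [h.neg.K_out i hi, h.neg.K_out (2 * n + 1 - i) (by omega)]
  | giout i hi => simp [h.neg.Ki_out i hi, h.neg.Ki_out (2 * n + 1 - i) (by omega)]
  | bout j hj => simpa using h.bGen_out hn hj
  | gg i j =>
    have c : ∀ a b, QE (q : ℂ) 0 (K a) (K b) := fun a b => QE.of_comm (h.neg.KK a b)
    have c2 : ∀ a b d, QE (q : ℂ) 0 (K a) (K b * K d) := fun a b d => (c a b).mul_right hq (c a d)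
    simpa [QE] using (c2 i j (2 * n + 1 - j)).mul_left hq (c2 (2 * n + 1 - i) j (2 * n + 1 - j))
  | ggi i => simpa using KKi' _ _
  | gig i => simpa using KiK' _ _
  | gsym i h1 h2 =>
    simp only [afaLift_fγ]
    rw [show 2 * n + 1 - (2 * n + 1 - i) = i by omega, h.neg.KK]
  | gb i j h1 h2 h3 h4 => simpa [QE] using h.KK_bGen (t := t) hq h1 h2 h4
  | bb i j h1 h2 h3 h4 hij =>
    rw [map_sub, map_mul, map_mul, afaLift_fβ, afaLift_fβ, h.bGen_comm hq h1 h2 h3 h4 hij,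
      apply_ite (afaLift _ _ _)]
    simp
  | serre1 i h1 h2 =>
    have := h.bGen_serre_up (t := t) hq hq2 h1 h2
    rw [apply_ite (afaLift _ _ _)]
    by_cases hi : i = n
    · subst hi
      simpa [Tp, -Complex.coe_smul, en] using this
    · simpa [Tp, -Complex.coe_smul, en, hi] using this
  | serre2 i h1 h2 =>
    obtain ⟨i, rfl⟩ : ∃ k, i = k + 1 := ⟨i - 1, by omega⟩
    have := h.bGen_serre_down (t := t) hq hq2 (i := i) (by omega) (by omega)
    rw [apply_ite (afaLift _ _ _)]
    by_cases hi : i + 1 = n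
    · subst hi
      simpa [Tp, -Complex.coe_smul, en] using this
    · simpa [Tp, -Complex.coe_smul, en, hi] using this

end UqRep

end Coideal

section Verma

variable {A B : Type*} [Ring A] [Algebra ℂ A] [Ring B] [Algebra ℂ B]

theorem afaLift_apply_mul_mem (f : AFA →ₐ[ℂ] A) (P : Submodule ℂ A)
    (hγ : ∀ i, ∀ x ∈ P, f (fγ i) * x ∈ P) (hγi : ∀ i, ∀ x ∈ P, f (fγi i) * x ∈ P)
    (hβ : ∀ i, ∀ x ∈ P, f (fβ i) * x ∈ P) (a : AFA) : ∀ x ∈ P, f a * x ∈ P := by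
  induction a using FreeAlgebra.induction with
  | grade0 r =>
    intro x hx
    rw [AlgHom.commutes, ← Algebra.smul_def]
    exact P.smul_mem r hx
  | grade1 g =>
    cases g with
    | g i => exact hγ i
    | gi i => exact hγi i
    | b i => exact hβ i
  | mul a b ha hb =>
    intro x hx
    rw [map_mul, mul_assoc]
    exact ha _ (hb x hx)
  | add a b ha hb =>
    intro x hx
    rw [map_add, add_mul]
    exact P.add_mem (ha x hx) (hb x hx)

theorem nq_induction {q : ℂ} {m : ℕ} (P : Submodule ℂ (Nq q m)) (h1 : 1 ∈ P)
    (hK : ∀ i, ∀ x ∈ P, nK q m i * x ∈ P) (hKi : ∀ i, ∀ x ∈ P, nKi q m i * x ∈ P)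
    (hF : ∀ i, ∀ x ∈ P, nF q m i * x ∈ P) (x : Nq q m) : x ∈ P := by
  obtain ⟨a, rfl⟩ := RingQuot.mkAlgHom_surjective ℂ (NRel q m) x
  simpa using afaLift_apply_mul_mem (RingQuot.mkAlgHom ℂ (NRel q m)) P hK hKi hF a 1 h1

/-- The Cartan part of the commutator of opposite Chevalley generators. -/
noncomputable def cartan (u : ℂ) (m : ℕ) (K Ki : ℕ → A) (i : ℕ) : A :=
  if 1 ≤ i ∧ i + 1 ≤ m then u • (K i * Ki (i + 1) - Ki i * K (i + 1)) else 0

theorem cartan_swap (u : ℂ) (m : ℕ) (K Ki : ℕ → A) (i : ℕ) :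
    cartan u m K Ki i = cartan (-u) m Ki K i := by
  unfold cartan
  split_ifs
  · module
  · rfl

theorem QE.add_right {q : ℂ} {k : ℤ} {a b c : A} (h : QE q k a b) (h' : QE q k a c) :
    QE q k a (b + c) := by
  unfold QE at *
  rw [mul_add, add_mul, h, h', smul_add]

theorem QE.smul_right {q : ℂ} {k : ℤ} {a b : A} (h : QE q k a b) (c : ℂ) : QE q k a (c • b) := by
  unfold QE at *
  rw [mul_smul_comm, h, smul_mul_assoc, smul_comm]

theorem QE.sub_right {q : ℂ} {k : ℤ} {a b c : A} (h : QE q k a b) (h' : QE q k a c) :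
    QE q k a (b - c) := by
  unfold QE at *
  rw [mul_sub, sub_mul, h, h', smul_sub]

theorem QE.tp_right {q p s : ℂ} (hq : q ≠ 0) {k l : ℤ} {c a b : A} (h : QE q k c a)
    (h' : QE q l c b) : QE q (k + k + l) c (Tp p s a b) := by
  rw [Tp, pow_two]
  refine ((QE.sub_right ?_ ?_).add_right ?_) <;> refine QE.smul_right ?_ _
  · exact (h.mul_right hq h).mul_right hq h'
  · exact ((h.mul_right hq h').mul_right hq h).congr (by ring)
  · exact (h'.mul_right hq (h.mul_right hq h)).congr (by ring)

namespace Borel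

variable {q : ℂ} {m : ℕ} {K Ki F : ℕ → A}

theorem map (h : Borel q m K Ki F) (f : A →ₐ[ℂ] B) :
    Borel q m (fun i => f (K i)) (fun i => f (Ki i)) (fun i => f (F i)) where
  K_out i hi := by simp [h.K_out i hi]
  Ki_out i hi := by simp [h.Ki_out i hi]
  F_out i hi := by simp [h.F_out i hi]
  KK i j := by rw [← map_mul, h.KK, map_mul]
  KKi i := by rw [← map_mul, h.KKi, map_one]
  KiK i := by rw [← map_mul, h.KiK, map_one]
  KF i j := by rw [QE, ← map_mul, ← map_mul, h.KF, map_smul]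
  FF i j hij := by rw [← map_mul, h.FF i j hij, map_mul]
  serre i j hij := by rw [← map_Tp, h.serre i j hij, map_zero]

theorem K_cartan (h : Borel q m K Ki F) (u : ℂ) (k i : ℕ) :
    QE q 0 (K k) (cartan u m K Ki i) := by
  have h1 : ∀ a b, K k * (K a * Ki b) = K a * Ki b * K k := fun a b => by
    rw [← mul_assoc, h.KK, mul_assoc, h.K_comm_Ki, mul_assoc]
  have h2 : ∀ a b, K k * (Ki a * K b) = Ki a * K b * K k := fun a b => by
    rw [← mul_assoc, h.K_comm_Ki, mul_assoc, h.KK, mul_assoc]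
  unfold cartan
  split_ifs
  · exact ((QE.of_comm (h1 _ _)).sub_right (QE.of_comm (h2 _ _))).smul_right _
  · simp [QE]

end Borel

namespace Weights

variable {q : ℂ} {K Ki F : ℕ → A}

theorem K_mul_Ki_F (h : Weights q K Ki F) (hq : q ≠ 0) (i j : ℕ) :
    QE q (kd i (j + 1) - kd i j + (kd (i + 1) j - kd (i + 1) (j + 1))) (K i * Ki (i + 1)) (F j) :=
  (h.KF _ _).mul_left hq (h.KiF hq _ _)

theorem Ki_mul_K_F (h : Weights q K Ki F) (hq : q ≠ 0) (i j : ℕ) :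
    QE q (kd i j - kd i (j + 1) + (kd (i + 1) (j + 1) - kd (i + 1) j)) (Ki i * K (i + 1)) (F j) :=
  (h.KiF hq _ _).mul_left hq (h.KF _ _)

theorem cartan_F (h : Weights q K Ki F) (hq : q ≠ 0) (u : ℂ) (m : ℕ) {i j : ℕ}
    (hij : i + 2 ≤ j ∨ j + 2 ≤ i) : cartan u m K Ki i * F j = F j * cartan u m K Ki i := by
  have h1 := (h.K_mul_Ki_F hq i j).congr (l := 0) (by simp only [kd]; split_ifs <;> omega)
  have h2 := (h.Ki_mul_K_F hq i j).congr (l := 0) (by simp only [kd]; split_ifs <;> omega)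
  rw [QE, zpow_zero, one_smul] at h1 h2
  unfold cartan
  split_ifs
  · rw [smul_mul_assoc, sub_mul, h1, h2, ← mul_sub, mul_smul_comm]
  · simp

theorem variation_left (h : Weights q K Ki F) (hq : q ≠ 0) (u : ℂ) (m : ℕ) {i j : ℕ}
    (hij : i + 1 = j ∨ j + 1 = i) :
    (cartan u m K Ki i * F i + F i * cartan u m K Ki i) * F j
      - (q + q⁻¹) • (cartan u m K Ki i * F j * F i + F i * F j * cartan u m K Ki i)
      + F j * (cartan u m K Ki i * F i + F i * cartan u m K Ki i) = 0 := by
  have two : q ^ (2 : ℤ) = q ^ 2 := by norm_cast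
  have ntwo : q ^ (-2 : ℤ) = (q ^ 2)⁻¹ := by rw [zpow_neg, two]
  unfold cartan
  split_ifs
  · refine serre_variation_left hq ?_ ?_ ?_ ?_
    · exact (h.K_mul_Ki_F hq i i).eq (zpow_eq_of_eq (by simp [kd]) ntwo)
    · exact (h.Ki_mul_K_F hq i i).eq (zpow_eq_of_eq (by simp [kd]) two)
    · exact (h.K_mul_Ki_F hq i j).eq
        (zpow_eq_of_eq (by simp only [kd]; split_ifs <;> omega) (zpow_one q))
    · exact (h.Ki_mul_K_F hq i j).eq
        (zpow_eq_of_eq (by simp only [kd]; split_ifs <;> omega) (zpow_neg_one q))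
  · simp

theorem variation_right (h : Weights q K Ki F) (hq : q ≠ 0) (u : ℂ) (m : ℕ) {i j : ℕ}
    (hij : i + 1 = j ∨ j + 1 = i) :
    F i ^ 2 * cartan u m K Ki j - (q + q⁻¹) • (F i * cartan u m K Ki j * F i)
      + cartan u m K Ki j * F i ^ 2 = 0 := by
  unfold cartan
  split_ifs
  · refine serre_variation_right hq ?_ ?_
    · exact (h.K_mul_Ki_F hq j i).eq
        (zpow_eq_of_eq (by simp only [kd]; split_ifs <;> omega) (zpow_one q))
    · exact (h.Ki_mul_K_F hq j i).eq
        (zpow_eq_of_eq (by simp only [kd]; split_ifs <;> omega) (zpow_neg_one q))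
  · simp

/-- Both first-order variations of the Serre polynomial vanish simultaneously. -/
theorem variation (h : Weights q K Ki F) (hq : q ≠ 0) (u : ℂ) (m : ℕ) {i j : ℕ}
    (hij : i + 1 = j ∨ j + 1 = i) (k : ℕ) {α β : A}
    (hα : α = if i = k then cartan u m K Ki k else 0)
    (hβ : β = if j = k then cartan u m K Ki k else 0) :
    (α * F i + F i * α) * F j - (q + q⁻¹) • (α * F j * F i + F i * F j * α)
      + F j * (α * F i + F i * α)
      + (F i ^ 2 * β - (q + q⁻¹) • (F i * β * F i) + β * F i ^ 2) = 0 := by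
  subst hα hβ
  by_cases hi : i = k
  · subst hi
    simpa [show j ≠ i by omega] using h.variation_left hq u m hij
  · by_cases hj : j = k
    · subst hj
      simpa [hi] using h.variation_right hq u m hij
    · simp [hi, hj]

end Weights

theorem nq_end_eq_zero {q : ℂ} (hq : q ≠ 0) {m : ℕ} {T : Module.End ℂ (Nq q m)} (c : ℕ → ℤ)
    (h1 : T 1 = 0) (hK : ∀ k, QE q (c k) (Algebra.lmul ℂ (Nq q m) (nK q m k)) T)
    (hF : ∀ k, T * Algebra.lmul ℂ (Nq q m) (nF q m k) = Algebra.lmul ℂ (Nq q m) (nF q m k) * T) :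
    T = 0 := by
  have hL := (borel_nq q m).map (B := Module.End ℂ (Nq q m)) (Algebra.lmul ℂ (Nq q m))
  have key : ∀ {g : Nq q m} {k : ℤ}, QE q k (Algebra.lmul ℂ (Nq q m) g) T →
      ∀ x ∈ LinearMap.ker T, g * x ∈ LinearMap.ker T := by
    intro g k hg x hx
    have := LinearMap.congr_fun (hg.symm hq) x
    simp only [Module.End.mul_apply, Algebra.coe_lmul_eq_mul, LinearMap.mul_apply',
      LinearMap.smul_apply] at this
    rw [LinearMap.mem_ker] at hx ⊢
    rw [this, hx, mul_zero, smul_zero]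
  refine LinearMap.ext fun x => nq_induction (LinearMap.ker T) h1 (fun i => key (hK i))
    (fun i => key ((hK i).inv_left hq (hL.KKi i) (hL.KiK i)))
    (fun i => key (k := 0) (QE.of_comm (hF i).symm)) x

end Verma

section Verma

section Matrices

variable {A : Type*} [Ring A]

/-- An upper triangular `2 × 2` matrix. -/
def upper (a b d : A) : Matrix (Fin 2) (Fin 2) A := !![a, b; 0, d]

theorem upper_mul (a b d a' b' d' : A) :
    upper a b d * upper a' b' d' = upper (a * a') (a * b' + b * d') (d * d') := by
  simp [upper]

theorem upper_smul [Algebra ℂ A] (c : ℂ) (a b d : A) : c • upper a b d =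
    upper (c • a) (c • b) (c • d) := by
  simp [upper, Matrix.smul_of]

theorem upper_add (a b d a' b' d' : A) :
    upper a b d + upper a' b' d' = upper (a + a') (b + b') (d + d') := by
  simp [upper]

theorem upper_sub (a b d a' b' d' : A) :
    upper a b d - upper a' b' d' = upper (a - a') (b - b') (d - d') := by
  simp [upper, sub_eq_add_neg]

theorem upper_one : upper 1 0 1 = (1 : Matrix (Fin 2) (Fin 2) A) := by
  simp [upper, Matrix.one_fin_two]

theorem upper_zero : upper 0 0 0 = (0 : Matrix (Fin 2) (Fin 2) A) := by
  ext i j; fin_cases i <;> fin_cases j <;> rfl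

theorem sub_mul_comm_of_twisted {a b F α β : A} (hα : a * F = F * a + α) (hβ : b * F = F * b + β)
    (hαb : α * b = b * α) (haβ : a * β = β * a) :
    (a * b - b * a) * F = F * (a * b - b * a) := by
  rw [sub_mul, mul_assoc, mul_assoc, hα, hβ, mul_add, mul_add, ← mul_assoc, ← mul_assoc, hα, hβ,
    add_mul, add_mul, hαb, haβ]
  noncomm_ring

theorem Tp_upper [Algebra ℂ A] (s : ℂ) (a α b β : A) :
    Tp 1 s (upper a α a) (upper b β b) = upper (Tp 1 s a b)
      ((α * a + a * α) * b - s • (α * b * a + a * b * α) + b * (α * a + a * α)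
        + (a ^ 2 * β - s • (a * β * a) + β * a ^ 2)) (Tp 1 s a b) := by
  simp only [Tp, pow_two, upper_mul, upper_smul, upper_add, upper_sub, inv_one, one_smul, mul_add,
    add_mul, smul_add, mul_assoc]
  congr 1
  abel

end Matrices

namespace Borel

variable {A : Type*} [Ring A] [Algebra ℂ A] {q : ℂ} {m : ℕ} {K Ki F : ℕ → A}

/-- The infinitesimal deformation of the nonpositive part along the `i`-th Cartan commutator. -/
theorem upper_borel (h : Borel q m K Ki F) (hq : q ≠ 0) (u : ℂ) {i : ℕ} (h1 : 1 ≤ i)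
    (h2 : i + 1 ≤ m) :
    Borel q m (fun k => upper (q ^ (kd k (i + 1) - kd k i) • K k) 0 (K k))
      (fun k => upper (q ^ (kd k i - kd k (i + 1)) • Ki k) 0 (Ki k))
      (fun j => upper (F j) (if j = i then cartan u m K Ki i else 0) (F j)) where
  K_out k hk := by
    rw [h.K_out k hk, kd, kd, if_neg (by omega), if_neg (by omega)]
    simpa using upper_one
  Ki_out k hk := by
    rw [h.Ki_out k hk, kd, kd, if_neg (by omega), if_neg (by omega)]
    simpa using upper_one
  F_out j hj := by
    rw [h.F_out j hj, if_neg (by rintro rfl; exact hj ⟨h1, h2⟩), upper_zero]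
  KK k l := by
    simp only [upper_mul, smul_mul_assoc, mul_smul_comm, h.KK k l]
    rw [smul_comm]; simp
  KKi k := by
    simp only [upper_mul, smul_mul_assoc, mul_smul_comm, h.KKi, smul_smul]
    rw [← zpow_add₀ hq]; simpa using upper_one
  KiK k := by
    simp only [upper_mul, smul_mul_assoc, mul_smul_comm, h.KiK, smul_smul]
    rw [← zpow_add₀ hq]; simpa using upper_one
  KF k j := by
    have hc := h.K_cartan u k i
    rw [QE, zpow_zero, one_smul] at hc
    rw [QE, upper_mul, upper_mul, upper_smul, smul_mul_assoc, mul_smul_comm]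
    rw [show K k * F j = _ from h.KF k j]
    congr 1
    · rw [smul_comm]
    · split_ifs with hj
      · subst hj
        rw [zero_mul, mul_zero, add_zero, zero_add, smul_mul_assoc, hc]
      · simp
  FF j k hjk := by
    rw [upper_mul, upper_mul, h.FF j k hjk]
    congr 1
    by_cases hj : j = i
    · subst hj
      rw [if_pos rfl, if_neg (by omega), h.cartan_F hq u m hjk]
      simp
    · by_cases hk : k = i
      · subst hk
        rw [if_pos rfl, if_neg hj, h.cartan_F hq u m hjk.symm]
        simp
      · simp [hj, hk]
  serre j k hjk := by
    rw [Tp_upper, h.serre j k hjk, h.variation hq u m hjk i rfl rfl, upper_zero]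

end Borel

theorem exists_verma_raising {q : ℂ} (hq : q ≠ 0) (m : ℕ) (u : ℂ) (i : ℕ) :
    ∃ E : Module.End ℂ (Nq q m), (¬(1 ≤ i ∧ i + 1 ≤ m) → E = 0) ∧ E 1 = 0 ∧
      (∀ k x, E (nK q m k * x) = q ^ (kd k (i + 1) - kd k i) • (nK q m k * E x)) ∧
      ∀ j x, E (nF q m j * x) = nF q m j * E x +
        (if j = i then cartan u m (nK q m) (nKi q m) i else 0) * x := by
  by_cases hi : 1 ≤ i ∧ i + 1 ≤ m
  · have h := (borel_nq q m).upper_borel hq u hi.1 hi.2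
    let f := h.lift
    have hf : ∀ x, f x 1 1 = x := fun x => by
      let P : Submodule ℂ (Nq q m) :=
        { carrier := {x | f x 1 1 = x}
          add_mem' := fun {a b} ha hb => by
            simp only [Set.mem_ofPred_eq] at *; rw [map_add, Matrix.add_apply, ha, hb]
          zero_mem' := by simp
          smul_mem' := fun c a ha => by
            simp only [Set.mem_ofPred_eq] at *; rw [map_smul, Matrix.smul_apply, ha] }
      have gen : ∀ g a b, f g = upper a b g → ∀ x ∈ P, g * x ∈ P := fun g a b hg x hx => by
        change f (g * x) 1 1 = g * x
        rw [map_mul, hg, Matrix.mul_apply, Fin.sum_univ_two, show f x 1 1 = x from hx]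
        simp [upper]
      exact nq_induction P (by simp [P]) (fun k => gen _ _ _ (h.lift_nK k))
        (fun k => gen _ _ _ (h.lift_nKi k)) (fun k => gen _ _ _ (h.lift_nF k)) x
    refine ⟨(Matrix.entryLinearMap ℂ (Nq q m) 0 1).comp f.toLinearMap, fun h' => absurd hi h',
      by simp, fun k x => ?_, fun j x => ?_⟩
    · change f (_ * _) 0 1 = _ • (_ * f x 0 1)
      rw [map_mul, show f (nK q m k) = _ from h.lift_nK k, Matrix.mul_apply, Fin.sum_univ_two]
      simp [upper]
    · change f (_ * _) 0 1 = _ * f x 0 1 + _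
      rw [map_mul, show f (nF q m j) = _ from h.lift_nF j, Matrix.mul_apply, Fin.sum_univ_two, hf]
      simp [upper]
  · exact ⟨0, fun _ => rfl, by simp, by simp, fun j x => by rw [cartan, if_neg hi]; simp⟩

/-- The action of `U_q(gl(m))` on its nonpositive part, the universal Verma module. -/
theorem exists_verma {q : ℂ} (hq : q ≠ 0) (m : ℕ) :
    ∃ E : ℕ → Module.End ℂ (Nq q m),
      UqRep q m (fun i => Algebra.lmul ℂ (Nq q m) (nK q m i))
        (fun i => Algebra.lmul ℂ (Nq q m) (nKi q m i)) E
        (fun i => Algebra.lmul ℂ (Nq q m) (nF q m i)) := by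
  set u := (q - q⁻¹)⁻¹ with hu
  choose E E_out E_one E_K E_F using exists_verma_raising hq m u
  let K : ℕ → Module.End ℂ (Nq q m) := fun i => Algebra.lmul ℂ (Nq q m) (nK q m i)
  let Ki : ℕ → Module.End ℂ (Nq q m) := fun i => Algebra.lmul ℂ (Nq q m) (nKi q m i)
  let F : ℕ → Module.End ℂ (Nq q m) := fun i => Algebra.lmul ℂ (Nq q m) (nF q m i)
  have hb : Borel q m K Ki F :=
    (borel_nq q m).map (B := Module.End ℂ (Nq q m)) (Algebra.lmul ℂ (Nq q m))
  have Lc : ∀ i, cartan u m K Ki i = Algebra.lmul ℂ _ (cartan u m (nK q m) (nKi q m) i) :=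
    fun i => by unfold cartan; split_ifs <;> simp only [K, Ki, map_smul, map_sub, map_mul, map_zero]
  have EK : ∀ k i, QE q (kd k i - kd k (i + 1)) (K k) (E i) := fun k i => by
    have : QE q (kd k (i + 1) - kd k i) (E i) (K k) := LinearMap.ext (E_K i k)
    exact (this.symm hq).congr (by ring)
  have EF : ∀ i j, E i * F j = F j * E i + (if i = j then cartan u m K Ki j else 0) :=
    fun i j => by
      refine LinearMap.ext fun x => (E_F i j x).trans (congrArg (nF q m j * E i x + ·) ?_)
      by_cases hij : i = j
      · subst hij
        rw [if_pos rfl, if_pos rfl, Lc]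
        rfl
      · rw [if_neg hij, if_neg (Ne.symm hij), zero_mul]
        rfl
  have hw : Weights q Ki K E :=
    { KK := hb.Ki_comm
      KKi := hb.KiK
      KiK := hb.KKi
      KF := fun k i => ((EK k i).inv_left hq (hb.KKi k) (hb.KiK k)).congr (by ring) }
  have Ec : ∀ {i k}, (i + 2 ≤ k ∨ k + 2 ≤ i) → 
      cartan u m K Ki i * E k = E k * cartan u m K Ki i := fun hik => by
    rw [cartan_swap]; exact hw.cartan_F hq _ m hik
  refine ⟨E, hb,
    { hw with
      K_out := hb.Ki_out, Ki_out := hb.K_out, F_out := E_out, FF := ?_, serre := ?_ },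
    ?_, ?_⟩
  · intro i j hij
    refine sub_eq_zero.1 (nq_end_eq_zero hq _ (by simp [E_one]) (fun k => QE.sub_right
      ((EK k i).mul_right hq (EK k j)) (((EK k j).mul_right hq (EK k i)).congr (by ring)))
      fun k => ?_)
    refine sub_mul_comm_of_twisted (EF i k) (EF j k) ?_ ?_
    · split_ifs with h
      · exact Ec (h ▸ hij)
      · simp
    · split_ifs with h
      · exact (Ec (h ▸ hij.symm)).symm
      · simp
  · intro i j hij
    refine nq_end_eq_zero hq _ (by simp [Tp, pow_two, E_one])
      (fun k => QE.tp_right hq (EK k i) (EK k j)) fun k => ?_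
    refine (Tp_mul_sub_mul_Tp (EF i k) (EF j k)).trans ?_
    rw [add_assoc, hw.variation hq (-u) m hij k (by rw [cartan_swap]) (by rw [cartan_swap]),
      add_zero]
  · intro i j hij
    exact (EF i j).trans (by rw [if_neg hij, add_zero])
  · intro i h1 h2
    refine sub_eq_of_eq_add' ((EF i i).trans ?_)
    rw [if_pos rfl, cartan, if_pos ⟨h1, h2⟩]

end Verma

section Homogeneous

variable {A : Type*} [Ring A] [Algebra ℂ A]

/-- The homogeneous version of the defining relations of `𝒜`, in which all terms of lower degree
in the `β_j` are dropped. -/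
inductive HRel (q : ℂ) (n : ℕ) : AFA → AFA → Prop
  | gout : ∀ i, ¬(1 ≤ i ∧ i ≤ 2 * n) → HRel q n (fγ i) 1
  | giout : ∀ i, ¬(1 ≤ i ∧ i ≤ 2 * n) → HRel q n (fγi i) 1
  | bout : ∀ j, ¬(1 ≤ j ∧ j + 1 ≤ 2 * n) → HRel q n (fβ j) 0
  | gg : ∀ i j, HRel q n (fγ i * fγ j) (fγ j * fγ i)
  | ggi : ∀ i, HRel q n (fγ i * fγi i) 1
  | gig : ∀ i, HRel q n (fγi i * fγ i) 1
  | gsym : ∀ i, 1 ≤ i → i ≤ 2 * n → HRel q n (fγ i) (fγ (2 * n + 1 - i))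
  | gb : ∀ i j, 1 ≤ i → i ≤ 2 * n → 1 ≤ j → j + 1 ≤ 2 * n →
      HRel q n (fγ i * fβ j) (q ^ (-(gex n i j)) • (fβ j * fγ i))
  | bb : ∀ i j, 1 ≤ i → i + 1 ≤ 2 * n → 1 ≤ j → j + 1 ≤ 2 * n → (i + 2 ≤ j ∨ j + 2 ≤ i) →
      HRel q n (fβ i * fβ j) (fβ j * fβ i)
  | serre_up : ∀ i, 1 ≤ i → i + 2 ≤ 2 * n → HRel q n (Tp q (q + q⁻¹) (fβ i) (fβ (i + 1))) 0
  | serre_down : ∀ i, 2 ≤ i → i + 1 ≤ 2 * n → HRel q n (Tp q⁻¹ (q + q⁻¹) (fβ i) (fβ (i - 1))) 0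

/-- Elements satisfying the homogeneous relations. -/
def HRep (q : ℂ) (n : ℕ) (g gi b : ℕ → A) : Prop :=
  ∀ ⦃x y⦄, HRel q n x y → afaLift g gi b x = afaLift g gi b y

/-- The algebra defined by the homogeneous relations. -/
abbrev Hq (q : ℂ) (n : ℕ) := RingQuot (HRel q n)

noncomputable def hγ (q : ℂ) (n i : ℕ) : Hq q n := RingQuot.mkAlgHom ℂ (HRel q n) (fγ i)
noncomputable def hγi (q : ℂ) (n i : ℕ) : Hq q n := RingQuot.mkAlgHom ℂ (HRel q n) (fγi i)
noncomputable def hβ (q : ℂ) (n i : ℕ) : Hq q n := RingQuot.mkAlgHom ℂ (HRel q n) (fβ i)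

theorem afaLift_hq (q : ℂ) (n : ℕ) :
    afaLift (hγ q n) (hγi q n) (hβ q n) = RingQuot.mkAlgHom ℂ (HRel q n) :=
  afa_hom_ext (by simp [hγ]) (by simp [hγi]) (by simp [hβ])

theorem hRep_hq (q : ℂ) (n : ℕ) : HRep q n (hγ q n) (hγi q n) (hβ q n) := fun x y h => by
  rw [afaLift_hq]; exact RingQuot.mkAlgHom_rel ℂ h

theorem HRep.scale {q : ℂ} {n : ℕ} {g gi b : ℕ → A} (h : HRep q n g gi b) (c : ℕ → ℂ) :
    HRep q n g gi (fun j => c j • b j) := fun x y hxy => by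
  have hx := h hxy
  cases hxy with
  | gout i hi => simpa using hx
  | giout i hi => simpa using hx
  | bout j hj =>
    have : b j = 0 := by simpa using hx
    simp [this]
  | gg i j => simpa using hx
  | ggi i => simpa using hx
  | gig i => simpa using hx
  | gsym i h1 h2 => simpa using hx
  | gb i j =>
    have : g i * b j = q ^ (-(gex n i j)) • (b j * g i) := by simpa using hx
    simp only [map_mul, map_smul, afaLift_fγ, afaLift_fβ, mul_smul_comm, smul_mul_assoc, this]
    rw [smul_comm]
  | bb i j =>
    have : b i * b j = b j * b i := by simpa using hx
    simp only [map_mul, afaLift_fβ, mul_smul_comm, smul_mul_assoc, this]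
    rw [smul_comm]
  | serre_up i =>
    have : Tp q (q + q⁻¹) (b i) (b (i + 1)) = 0 := by simpa [map_Tp] using hx
    simp [map_Tp, Tp_smul, this]
  | serre_down i =>
    have : Tp q⁻¹ (q + q⁻¹) (b i) (b (i - 1)) = 0 := by simpa [map_Tp] using hx
    simp [map_Tp, Tp_smul, this]

theorem hq_induction {q : ℂ} {n : ℕ} (P : Submodule ℂ (Hq q n)) (h1 : 1 ∈ P)
    (hg : ∀ i, ∀ x ∈ P, hγ q n i * x ∈ P) (hgi : ∀ i, ∀ x ∈ P, hγi q n i * x ∈ P)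
    (hb : ∀ i, ∀ x ∈ P, hβ q n i * x ∈ P) (x : Hq q n) : x ∈ P := by
  obtain ⟨a, rfl⟩ := RingQuot.mkAlgHom_surjective ℂ (HRel q n) x
  simpa using afaLift_apply_mul_mem (RingQuot.mkAlgHom ℂ (HRel q n)) P hg hgi hb a 1 h1

/-- The automorphism scaling `β_j` by `q ^ d j`. -/
noncomputable def hScale (q : ℂ) (n : ℕ) (d : ℕ → ℤ) : Hq q n →ₐ[ℂ] Hq q n :=
  RingQuot.liftAlgHom ℂ ⟨_, (hRep_hq q n).scale fun j => q ^ d j⟩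

section

variable (q : ℂ) (n : ℕ) (d e : ℕ → ℤ)

@[simp] theorem hScale_hγ (i : ℕ) : hScale q n d (hγ q n i) = hγ q n i :=
  (RingQuot.liftAlgHom_mkAlgHom_apply ..).trans (by simp)

@[simp] theorem hScale_hγi (i : ℕ) : hScale q n d (hγi q n i) = hγi q n i :=
  (RingQuot.liftAlgHom_mkAlgHom_apply ..).trans (by simp)

@[simp] theorem hScale_hβ (j : ℕ) : hScale q n d (hβ q n j) = q ^ d j • hβ q n j :=
  (RingQuot.liftAlgHom_mkAlgHom_apply ..).trans (by simp)

end

theorem hq_hom_ext {q : ℂ} {n : ℕ} {f g : Hq q n →ₐ[ℂ] A} (h₁ : ∀ i, f (hγ q n i) = g (hγ q n i))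
    (h₂ : ∀ i, f (hγi q n i) = g (hγi q n i)) (h₃ : ∀ i, f (hβ q n i) = g (hβ q n i)) : f = g :=
  RingQuot.ringQuot_ext' ℂ _ _ (afa_hom_ext h₁ h₂ h₃)

variable {q : ℂ} {n : ℕ}

theorem hScale_hScale (hq : q ≠ 0) (d e : ℕ → ℤ) (x : Hq q n) :
    hScale q n d (hScale q n e x) = hScale q n (d + e) x := by
  refine DFunLike.congr_fun (f := (hScale q n d).comp (hScale q n e)) (hq_hom_ext ?_ ?_ ?_) x
  · simp
  · simp
  · intro i
    simp [smul_smul, zpow_add₀ hq, mul_comm]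

theorem hβ_out {j : ℕ} (hj : ¬(1 ≤ j ∧ j + 1 ≤ 2 * n)) : hβ q n j = 0 := by
  simpa using hRep_hq q n (HRel.bout j hj)

theorem hScale_congr {d e : ℕ → ℤ} (h : ∀ j, 1 ≤ j → j + 1 ≤ 2 * n → d j = e j) :
    hScale q n d = hScale q n e := by
  refine hq_hom_ext (by simp) (by simp) fun j => ?_
  by_cases hj : 1 ≤ j ∧ j + 1 ≤ 2 * n
  · simp [h j hj.1 hj.2]
  · simp [hβ_out hj]

theorem hScale_zero : hScale q n 0 = AlgHom.id ℂ _ :=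
  hq_hom_ext (by simp) (by simp) (by simp)

/-- Right multiplication by `g` composed with a scaling. -/
noncomputable def hOp (q : ℂ) (n : ℕ) (d : ℕ → ℤ) (g : Hq q n) : Module.End ℂ (Hq q n) :=
  (LinearMap.mulRight ℂ g).comp (hScale q n d).toLinearMap

theorem hOp_apply (d : ℕ → ℤ) (g x : Hq q n) : hOp q n d g x = hScale q n d x * g := rfl

theorem hOp_mul (hq : q ≠ 0) {d e : ℕ → ℤ} {g g' : Hq q n} (h : hScale q n d g' = g') :
    hOp q n d g * hOp q n e g' = hOp q n (d + e) (g' * g) := by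
  refine LinearMap.ext fun x => ?_
  rw [Module.End.mul_apply, hOp_apply, hOp_apply, hOp_apply, map_mul, hScale_hScale hq, h,
    mul_assoc]

theorem hOp_zero_one : hOp q n 0 1 = 1 := by
  refine LinearMap.ext fun x => ?_
  rw [hOp_apply, hScale_zero]
  simp

theorem hOp_hβ (d : ℕ → ℤ) {g : Hq q n} (j : ℕ) :
    QE q (d j) (hOp q n d g) (Algebra.lmul ℂ (Hq q n) (hβ q n j)) := by
  refine LinearMap.ext fun x => ?_
  change hScale q n d (hβ q n j * x) * g = q ^ d j • (hβ q n j * (hScale q n d x * g))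
  rw [map_mul, hScale_hβ, smul_mul_assoc, smul_mul_assoc, mul_assoc]

end Homogeneous

section Twist

variable {q : ℂ} {n : ℕ}

/-- The power of `q` by which the `i`-th diagonal operator scales `β_j`. -/
def tExp (i j : ℕ) : ℤ := kd i (j + 1) - kd i j

/-- The element by which the `i`-th diagonal operator multiplies on the right. -/
noncomputable def tHalf (n : ℕ) (g : ℕ → Hq q n) (i : ℕ) : Hq q n := if i ≤ n then g i else 1

/-- The diagonal operators. -/
noncomputable def tK (q : ℂ) (n i : ℕ) : Module.End ℂ (Hq q n) :=
  hOp q n (tExp i) (tHalf n (hγ q n) i)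

/-- The inverse diagonal operators. -/
noncomputable def tKi (q : ℂ) (n i : ℕ) : Module.End ℂ (Hq q n) :=
  hOp q n (-tExp i) (tHalf n (hγi q n) i)

/-- The lowering operators. -/
noncomputable def tF (q : ℂ) (n j : ℕ) : Module.End ℂ (Hq q n) :=
  Algebra.lmul ℂ (Hq q n) (hβ q n j) * (tK q n (2 * n - j) * tK q n (j + 1))

theorem hScale_tHalf (d : ℕ → ℤ) (i : ℕ) :
    hScale q n d (tHalf n (hγ q n) i) = tHalf n (hγ q n) i := by
  unfold tHalf; split_ifs <;> simp

theorem hScale_tHalf_inv (d : ℕ → ℤ) (i : ℕ) :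
    hScale q n d (tHalf n (hγi q n) i) = tHalf n (hγi q n) i := by
  unfold tHalf; split_ifs <;> simp

theorem hγ_comm (i j : ℕ) : hγ q n i * hγ q n j = hγ q n j * hγ q n i := by
  simpa using hRep_hq q n (HRel.gg i j)

theorem hγ_mul_inv (i : ℕ) : hγ q n i * hγi q n i = 1 := by
  simpa using hRep_hq q n (HRel.ggi i)

theorem hγ_inv_mul (i : ℕ) : hγi q n i * hγ q n i = 1 := by
  simpa using hRep_hq q n (HRel.gig i)

theorem hγ_out {i : ℕ} (hi : ¬(1 ≤ i ∧ i ≤ 2 * n)) : hγ q n i = 1 := by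
  simpa using hRep_hq q n (HRel.gout i hi)

theorem hγi_out {i : ℕ} (hi : ¬(1 ≤ i ∧ i ≤ 2 * n)) : hγi q n i = 1 := by
  simpa using hRep_hq q n (HRel.giout i hi)

theorem tHalf_comm (i j : ℕ) : tHalf n (hγ q n) i * tHalf n (hγ q n) j =
    tHalf n (hγ q n) j * tHalf n (hγ q n) i := by
  unfold tHalf; split_ifs <;> simp [hγ_comm i j]

theorem tK_comm (hq : q ≠ 0) (i j : ℕ) : tK q n i * tK q n j = tK q n j * tK q n i := by
  simp only [tK]
  rw [hOp_mul hq (hScale_tHalf _ _), hOp_mul hq (hScale_tHalf _ _), tHalf_comm, add_comm]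

theorem tK_mul_tKi (hq : q ≠ 0) (i : ℕ) : tK q n i * tKi q n i = 1 := by
  rw [tK, tKi, hOp_mul hq (hScale_tHalf_inv _ _), add_neg_cancel]
  convert hOp_zero_one (q := q) (n := n)
  unfold tHalf; split_ifs <;> simp [hγ_inv_mul]

theorem tKi_mul_tK (hq : q ≠ 0) (i : ℕ) : tKi q n i * tK q n i = 1 := by
  rw [tK, tKi, hOp_mul hq (hScale_tHalf _ _), neg_add_cancel]
  convert hOp_zero_one (q := q) (n := n)
  unfold tHalf; split_ifs <;> simp [hγ_mul_inv]

theorem hOp_of_trivial {d : ℕ → ℤ} (hd : ∀ j, 1 ≤ j → j + 1 ≤ 2 * n → d j = 0) :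
    hOp q n d 1 = 1 := by
  rw [← hOp_zero_one, hOp, hOp, hScale_congr (e := 0) hd]

theorem tExp_out {i : ℕ} (hi : ¬(1 ≤ i ∧ i ≤ 2 * n)) {j : ℕ} (h1 : 1 ≤ j) (h2 : j + 1 ≤ 2 * n) :
    tExp i j = 0 := by
  rw [tExp, kd, kd, if_neg (by omega), if_neg (by omega), sub_zero]

theorem tHalf_eq_one {g : ℕ → Hq q n} {i : ℕ} (h : ¬(1 ≤ i ∧ i ≤ 2 * n) → g i = 1)
    (hi : ¬(1 ≤ i ∧ i ≤ 2 * n)) : tHalf n g i = 1 := by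
  rw [tHalf, h hi, ite_self]

theorem tK_out {i : ℕ} (hi : ¬(1 ≤ i ∧ i ≤ 2 * n)) : tK q n i = 1 := by
  rw [tK, tHalf_eq_one hγ_out hi, hOp_of_trivial fun _ h1 h2 => tExp_out hi h1 h2]

theorem tKi_out {i : ℕ} (hi : ¬(1 ≤ i ∧ i ≤ 2 * n)) : tKi q n i = 1 := by
  rw [tKi, tHalf_eq_one hγi_out hi, hOp_of_trivial fun _ h1 h2 => by
    rw [Pi.neg_apply, tExp_out hi h1 h2, neg_zero]]

theorem tK_lmul (i j : ℕ) :
    QE q (tExp i j) (tK q n i) (Algebra.lmul ℂ (Hq q n) (hβ q n j)) := hOp_hβ _ _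

theorem weights_twist (hq : q ≠ 0) : Weights q (tK q n) (tKi q n) (tF q n) where
  KK := tK_comm hq
  KKi := tK_mul_tKi hq
  KiK := tKi_mul_tK hq
  KF i j := ((tK_lmul i j).mul_right hq ((QE.of_comm (tK_comm hq _ _)).mul_right hq
    (QE.of_comm (tK_comm hq _ _)))).congr (by rw [tExp]; ring)

theorem tKK_lmul (hq : q ≠ 0) (i j : ℕ) :
    QE q (tExp (2 * n - i) j + tExp (i + 1) j) (tK q n (2 * n - i) * tK q n (i + 1))
      (Algebra.lmul ℂ (Hq q n) (hβ q n j)) :=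
  (tK_lmul _ _).mul_left hq (tK_lmul _ _)

theorem tKK_comm (hq : q ≠ 0) (i j k l : ℕ) :
    tK q n i * tK q n j * (tK q n k * tK q n l) = tK q n k * tK q n l * (tK q n i * tK q n j) := by
  have h : ∀ a b, Commute (tK q n a) (tK q n b) := tK_comm hq
  exact ((h i k).mul_right (h i l)).mul_left ((h j k).mul_right (h j l))

theorem tF_out {j : ℕ} (hj : ¬(1 ≤ j ∧ j + 1 ≤ 2 * n)) : tF q n j = 0 := by
  rw [tF, hβ_out hj, map_zero, zero_mul]

theorem lmul_Tp (p s : ℂ) (a b : Hq q n) :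
    Algebra.lmul ℂ (Hq q n) (Tp p s a b) =
      Tp p s (Algebra.lmul ℂ (Hq q n) a) (Algebra.lmul ℂ (Hq q n) b) :=
  map_Tp (B := Module.End ℂ (Hq q n)) _ p s a b

theorem tF_serre_of (hq : q ≠ 0) {i j : ℕ} {p : ℂ} (hp : p ≠ 0)
    (h : Tp p (q + q⁻¹) (hβ q n i) (hβ q n j) = 0)
    (hc : q ^ (tExp (2 * n - i) j + tExp (i + 1) j) * p =
      q ^ (tExp (2 * n - j) i + tExp (j + 1) i)) :
    Tp 1 (q + q⁻¹) (tF q n i) (tF q n j) = 0 := by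
  refine Tp_twist ?_ (tKK_lmul hq i i) (tKK_lmul hq i j) (tKK_lmul hq j i) (tKK_comm hq _ _ _ _) hp
    one_ne_zero (by rw [hc, one_mul])
  rw [← lmul_Tp, h, map_zero]

theorem borel_twist (hq : q ≠ 0) : Borel q (2 * n) (tK q n) (tKi q n) (tF q n) where
  toWeights := weights_twist hq
  K_out _ := tK_out
  Ki_out _ := tKi_out
  F_out _ := tF_out
  FF i j hij := by
    by_cases hi : 1 ≤ i ∧ i + 1 ≤ 2 * n
    · by_cases hj : 1 ≤ j ∧ j + 1 ≤ 2 * n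
      · have hb : hβ q n i * hβ q n j = hβ q n j * hβ q n i := by
          simpa using hRep_hq q n (HRel.bb i j hi.1 hi.2 hj.1 hj.2 hij)
        have hL : QE q 0 (Algebra.lmul ℂ (Hq q n) (hβ q n i))
            (Algebra.lmul ℂ (Hq q n) (hβ q n j)) :=
          QE.of_comm (by rw [← map_mul, hb, map_mul])
        have := ((hL.mul_right hq ((tKK_lmul hq j i).symm hq)).mul_left hq
          ((tKK_lmul hq i j).mul_right hq (QE.of_comm (tKK_comm hq _ _ _ _)))).congr (l := 0)
          (by simp only [tExp, kd]; split_ifs <;> omega)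
        simpa only [QE, zpow_zero, one_smul, tF] using this
      · rw [tF_out hj, mul_zero, zero_mul]
    · rw [tF_out hi, mul_zero, zero_mul]
  serre i j hij := by
    by_cases hi : 1 ≤ i ∧ i + 1 ≤ 2 * n
    · by_cases hj : 1 ≤ j ∧ j + 1 ≤ 2 * n
      · rcases hij with rfl | rfl
        · refine tF_serre_of hq hq (by simpa [map_Tp] using hRep_hq q n (HRel.serre_up i hi.1 hj.2))
              ?_
          rw [← zpow_add_one₀ hq]
          congr 1
          simp only [tExp, kd]; split_ifs <;> omega
        · refine tF_serre_of hq (inv_ne_zero hq) (by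
            simpa [map_Tp] using hRep_hq q n (HRel.serre_down (j + 1) (by omega) hi.2)) ?_
          rw [← zpow_sub_one₀ hq]
          congr 1
          simp only [tExp, kd]; split_ifs <;> omega
      · rw [tF_out hj]; simp [Tp]
    · rw [tF_out hi]; simp [Tp]

theorem hγ_mul {i : ℕ} (h1 : 1 ≤ i) (h2 : i ≤ 2 * n) (x : Hq q n) :
    hγ q n i * x = hScale q n (tExp i + tExp (2 * n + 1 - i)) x * hγ q n i := by
  let P : Submodule ℂ (Hq q n) := LinearMap.ker (LinearMap.mulLeft ℂ (hγ q n i) -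
    hOp q n (tExp i + tExp (2 * n + 1 - i)) (hγ q n i))
  have hP : ∀ {y}, y ∈ P ↔
      hγ q n i * y = hScale q n (tExp i + tExp (2 * n + 1 - i)) y * hγ q n i := by
    intro y
    rw [LinearMap.mem_ker, LinearMap.sub_apply, sub_eq_zero]
    rfl
  have hinv : ∀ k, hγ q n i * hγi q n k = hγi q n k * hγ q n i := fun k => by
    calc hγ q n i * hγi q n k = hγi q n k * (hγ q n k * hγ q n i) * hγi q n k := by
          rw [← mul_assoc, hγ_inv_mul, one_mul]
      _ = _ := by rw [hγ_comm, mul_assoc, mul_assoc, hγ_mul_inv, mul_one]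
  refine hP.1 (hq_induction P ?_ (fun k y hy => ?_) (fun k y hy => ?_) (fun k y hy => ?_) x)
  · simp [hP]
  · rw [hP] at hy ⊢
    rw [← mul_assoc, hγ_comm, mul_assoc, hy, map_mul, hScale_hγ, mul_assoc]
  · rw [hP] at hy ⊢
    rw [← mul_assoc, hinv, mul_assoc, hy, map_mul, hScale_hγi, mul_assoc]
  · rw [hP] at hy ⊢
    by_cases hk : 1 ≤ k ∧ k + 1 ≤ 2 * n
    · have : hγ q n i * hβ q n k = q ^ (-(gex n i k)) • (hβ q n k * hγ q n i) := by
        simpa using hRep_hq q n (HRel.gb i k h1 h2 hk.1 hk.2)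
      rw [← mul_assoc, this, smul_mul_assoc, mul_assoc, hy, map_mul, hScale_hβ, smul_mul_assoc,
        smul_mul_assoc, mul_assoc]
      congr 2
      simp only [gex, Pi.add_apply, tExp]
      ring
    · rw [hβ_out hk, zero_mul, mul_zero, map_zero, zero_mul]

theorem tK_mul_tK (hq : q ≠ 0) (i : ℕ) :
    tK q n i * tK q n (2 * n + 1 - i) = Algebra.lmul ℂ (Hq q n) (hγ q n i) := by
  by_cases hi : 1 ≤ i ∧ i ≤ 2 * n
  · rw [tK, tK, hOp_mul hq (hScale_tHalf _ _)]
    refine LinearMap.ext fun x => ?_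
    refine Eq.trans ?_ (hγ_mul hi.1 hi.2 x).symm
    rw [hOp_apply]
    congr 1
    unfold tHalf
    by_cases h : i ≤ n
    · rw [if_pos h, if_neg (by omega), one_mul]
    · rw [if_neg h, if_pos (by omega), mul_one]
      simpa using (hRep_hq q n (HRel.gsym i hi.1 hi.2)).symm
  · rw [tK_out hi, tK_out (by omega), hγ_out hi, map_one, one_mul]

theorem tKi_mul_tKi (hq : q ≠ 0) (i : ℕ) :
    tKi q n i * tKi q n (2 * n + 1 - i) = Algebra.lmul ℂ (Hq q n) (hγi q n i) := by
  refine left_inv_eq_right_inv (a := tK q n i * tK q n (2 * n + 1 - i)) ?_ ?_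
  · rw [(weights_twist hq).Ki_comm, mul_assoc, ← mul_assoc (tKi q n i), tKi_mul_tK hq, one_mul,
      tKi_mul_tK hq]
  · rw [tK_mul_tK hq, ← map_mul, hγ_mul_inv, map_one]

theorem yPart_twist (hq : q ≠ 0) (j : ℕ) :
    yPart n (tKi q n) (tF q n) j = Algebra.lmul ℂ (Hq q n) (hβ q n j) := by
  rw [yPart, tF, mul_assoc, mul_assoc, mul_assoc, ← mul_assoc (tK q n (j + 1)), tK_mul_tKi hq,
    one_mul, tK_mul_tKi hq, mul_one]

/-- The homomorphism sending the generators to the leading terms of the coideal generators. -/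
noncomputable def leadLift {A : Type*} [Ring A] [Algebra ℂ A] (n : ℕ) (K Ki F : ℕ → A) :
    AFA →ₐ[ℂ] A :=
  afaLift (fun i => K i * K (2 * n + 1 - i)) (fun i => Ki i * Ki (2 * n + 1 - i)) (yPart n Ki F)

theorem comp_leadLift {A B : Type*} [Ring A] [Algebra ℂ A] [Ring B] [Algebra ℂ B] {n : ℕ}
    {K Ki F : ℕ → A} {K' Ki' F' : ℕ → B} (f : A →ₐ[ℂ] B) (hK : ∀ i, f (K i) = K' i)
    (hKi : ∀ i, f (Ki i) = Ki' i) (hF : ∀ i, f (F i) = F' i) :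
    f.comp (leadLift n K Ki F) = leadLift n K' Ki' F' := by
  unfold leadLift
  refine afa_hom_ext (fun i => ?_) (fun i => ?_) (fun i => ?_)
  · simp [hK]
  · simp [hKi]
  · simp [yPart, hKi, hF]

/-- The homogeneous relations are a complete set of relations for the leading terms of the
coideal generators. -/
theorem mk_hq_eq_zero (hq : q ≠ 0) {a : AFA}
    (ha : leadLift n (nK q (2 * n)) (nKi q (2 * n)) (nF q (2 * n)) a = 0) :
    RingQuot.mkAlgHom ℂ (HRel q n) a = 0 := by
  have hb := borel_twist (n := n) hq
  let L : Hq q n →ₐ[ℂ] Module.End ℂ (Hq q n) := Algebra.lmul ℂ (Hq q n)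
  have h1 : leadLift n (tK q n) (tKi q n) (tF q n) a = 0 := by
    rw [← comp_leadLift _ hb.lift_nK hb.lift_nKi hb.lift_nF, AlgHom.comp_apply, ha, map_zero]
  have h2 : leadLift n (tK q n) (tKi q n) (tF q n) = L.comp (RingQuot.mkAlgHom ℂ (HRel q n)) := by
    unfold leadLift
    refine afa_hom_ext (A := Module.End ℂ (Hq q n)) (fun i => ?_) (fun i => ?_) (fun i => ?_)
    · rw [AlgHom.comp_apply, afaLift_fγ]
      exact tK_mul_tK hq i
    · rw [AlgHom.comp_apply, afaLift_fγi]
      exact tKi_mul_tKi hq i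
    · rw [AlgHom.comp_apply, afaLift_fβ]
      exact yPart_twist hq i
  rw [h2] at h1
  exact (mul_one _).symm.trans (LinearMap.congr_fun h1 1)

end Twist

theorem mk_hq_eq_zero_of_uq {q : ℝ} (hq : q ≠ 0) {n : ℕ} {a : AFA}
    (ha : leadLift n (uK q (2 * n)) (uKi q (2 * n)) (uF q (2 * n)) a = 0) :
    RingQuot.mkAlgHom ℂ (HRel (q : ℂ) n) a = 0 := by
  have hq' : (q : ℂ) ≠ 0 := by exact_mod_cast hq
  obtain ⟨E, h⟩ := exists_verma hq' (2 * n)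
  let L : Nq (q : ℂ) (2 * n) →ₐ[ℂ] Module.End ℂ (Nq (q : ℂ) (2 * n)) := Algebra.lmul ℂ _
  have h1 : (h.lift hq).comp (leadLift n (uK q (2 * n)) (uKi q (2 * n)) (uF q (2 * n))) =
      L.comp (leadLift n (nK q (2 * n)) (nKi q (2 * n)) (nF q (2 * n))) :=
    (comp_leadLift (B := Module.End ℂ (Nq (q : ℂ) (2 * n))) (h.lift hq) (UqRep.lift_uK hq h)
      (UqRep.lift_uKi hq h) (UqRep.lift_uF hq h)).trans
      (comp_leadLift (B := Module.End ℂ (Nq (q : ℂ) (2 * n))) L (fun _ => rfl) (fun _ => rfl)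
        (fun _ => rfl)).symm
  have h2 : L (leadLift n (nK q (2 * n)) (nKi q (2 * n)) (nF q (2 * n)) a) = 0 := by
    have := DFunLike.congr_fun h1 a
    rw [AlgHom.comp_apply, AlgHom.comp_apply, ha, map_zero] at this
    exact this.symm
  exact mk_hq_eq_zero hq' ((mul_one _).symm.trans (LinearMap.congr_fun h2 1))

section Laurent

open AddMonoidAlgebra

variable {A : Type*} [Ring A] [Algebra ℂ A]

theorem Tp_single (p s : ℂ) (k l : ℤ) (a b : A) :
    Tp p s (single k a) (single l b) = single (k + k + l) (Tp p s a b) := by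
  simp only [Tp, pow_two, single_mul_single, smul_single, single_add, single_sub]
  rw [show k + l + k = k + k + l by ring, show l + (k + k) = k + k + l by ring]

theorem QE_single {q : ℂ} {e : ℤ} {a b : A} (h : QE q e a b) (k l : ℤ) :
    QE q e (single k a) (single l b) := by
  unfold QE at *
  rw [single_mul_single, single_mul_single, h, smul_single, add_comm]

theorem Borel.single {q : ℂ} {m : ℕ} {K Ki F : ℕ → A} (h : Borel q m K Ki F) (k : ℤ) :
    Borel q m (fun i => AddMonoidAlgebra.single (0 : ℤ) (K i))
      (fun i => AddMonoidAlgebra.single (0 : ℤ) (Ki i))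
      (fun i => AddMonoidAlgebra.single k (F i)) where
  KK i j := by simp only [single_mul_single, h.KK i j]
  KKi i := by simp only [single_mul_single, h.KKi i, one_def, add_zero]
  KiK i := by simp only [single_mul_single, h.KiK i, one_def, add_zero]
  KF i j := QE_single (h.KF i j) _ _
  K_out i hi := by simp only [h.K_out i hi, one_def]
  Ki_out i hi := by simp only [h.Ki_out i hi, one_def]
  F_out i hi := by simp only [h.F_out i hi, single_zero]
  FF i j hij := by simp only [single_mul_single, h.FF i j hij]
  serre i j hij := by simp only [Tp_single, h.serre i j hij, single_zero]

theorem UqRep.single {q : ℂ} {m : ℕ} {K Ki E F : ℕ → A} (h : UqRep q m K Ki E F) :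
    UqRep q m (fun i => AddMonoidAlgebra.single (0 : ℤ) (K i))
      (fun i => AddMonoidAlgebra.single (0 : ℤ) (Ki i))
      (fun i => AddMonoidAlgebra.single (-1 : ℤ) (E i))
      (fun i => AddMonoidAlgebra.single (1 : ℤ) (F i)) where
  neg := h.neg.single 1
  pos := h.pos.single (-1)
  EF_ne i j hij := by simp only [single_mul_single, h.EF_ne i j hij, add_comm]
  EF i h1 h2 := by
    simp only [single_mul_single, ← single_sub, smul_single, ← h.EF i h1 h2, neg_add_cancel,
      add_neg_cancel, add_zero]

variable (A) in
/-- The Laurent polynomials of degree less than `d`. -/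
noncomputable def lowDegree (d : ℤ) : Submodule ℂ (AddMonoidAlgebra A ℤ) :=
  Submodule.span ℂ {z | ∃ e < d, ∃ u : A, z = single e u}

theorem single_mem_lowDegree {e d : ℤ} (h : e < d) (u : A) : single e u ∈ lowDegree A d :=
  Submodule.subset_span ⟨e, h, u, rfl⟩

theorem lowDegree_mono {d e : ℤ} (h : d ≤ e) : lowDegree A d ≤ lowDegree A e :=
  Submodule.span_mono fun _ ⟨k, hk, u, hu⟩ => ⟨k, hk.trans_le h, u, hu⟩

theorem coeff_eq_zero_of_mem_lowDegree {d : ℤ} {z : AddMonoidAlgebra A ℤ} (hz : z ∈ lowDegree A d)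
    {e : ℤ} (h : d ≤ e) : z.coeff e = 0 := by
  induction hz using Submodule.span_induction with
  | mem z hz =>
    obtain ⟨k, hk, u, rfl⟩ := hz
    rw [coeff_single, Finsupp.single_eq_of_ne (by omega)]
  | zero => simp
  | add x y _ _ hx hy => simp [hx, hy]
  | smul c x _ hx => simp [hx]

theorem lowDegree_mul {d e : ℤ} {x y : AddMonoidAlgebra A ℤ} (hx : x ∈ lowDegree A (d + 1))
    (hy : y ∈ lowDegree A e) : x * y ∈ lowDegree A (d + e) := by
  refine (?_ : lowDegree A (d + 1) * lowDegree A e ≤ lowDegree A (d + e))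
    (Submodule.mul_mem_mul hx hy)
  rw [lowDegree, lowDegree, Submodule.span_mul_span, Submodule.span_le]
  rintro _ ⟨_, ⟨k, hk, u, rfl⟩, _, ⟨l, hl, v, rfl⟩, rfl⟩
  simp only [single_mul_single, SetLike.mem_coe]
  exact single_mem_lowDegree (by omega) (u * v)

/-- `x` has degree at most `d`, with coefficient `u` in degree `d`. -/
def Lead (d : ℤ) (x : AddMonoidAlgebra A ℤ) (u : A) : Prop := x - single d u ∈ lowDegree A d

namespace Lead

variable {d e : ℤ} {x y : AddMonoidAlgebra A ℤ} {u v : A}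

theorem single (d : ℤ) (u : A) : Lead d (single d u) u := by simp [Lead]

theorem mem (h : Lead d x u) : x ∈ lowDegree A (d + 1) :=
  (sub_add_cancel x (AddMonoidAlgebra.single d u)) ▸ Submodule.add_mem _
    (lowDegree_mono (by omega) h)
    (single_mem_lowDegree (by omega) u)

theorem coeff (h : Lead d x u) : x.coeff d = u := by
  have := coeff_eq_zero_of_mem_lowDegree h le_rfl
  rwa [coeff_sub, Finsupp.sub_apply, coeff_single, Finsupp.single_eq_same, sub_eq_zero] at this

theorem add (h : Lead d x u) (h' : Lead d y v) : Lead d (x + y) (u + v) := by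
  unfold Lead at *
  rw [single_add, add_sub_add_comm]
  exact Submodule.add_mem _ h h'

theorem mul (h : Lead d x u) (h' : Lead e y v) : Lead (d + e) (x * y) (u * v) := by
  have : x * y - AddMonoidAlgebra.single (d + e) (u * v) =
      x * (y - AddMonoidAlgebra.single e v) +
        (x - AddMonoidAlgebra.single d u) * AddMonoidAlgebra.single e v := by
    rw [← single_mul_single]; noncomm_ring
  unfold Lead
  rw [this]
  refine Submodule.add_mem _ (lowDegree_mul h.mem h') ?_
  have := lowDegree_mul (d := d - 1) (by rwa [sub_add_cancel])
    (single_mem_lowDegree (lt_add_one e) v)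
  rwa [sub_add_add_cancel] at this

end Lead

end Laurent

section Filtration

open Polynomial

/-- The homomorphism multiplying each `β_j` by a central variable. -/
noncomputable def grade : AFA →ₐ[ℂ] AFA[X] :=
  afaLift (fun i => C (fγ i)) (fun i => C (fγi i)) (fun i => monomial 1 (fβ i))

/-- The component of degree `d` in the `β_j`. -/
noncomputable def comp (d : ℕ) (a : AFA) : AFA := (grade a).coeff d

theorem comp_add (d : ℕ) (a b : AFA) : comp d (a + b) = comp d a + comp d b := by simp [comp]

theorem comp_sub (d : ℕ) (a b : AFA) : comp d (a - b) = comp d a - comp d b := by simp [comp]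

theorem comp_smul (d : ℕ) (c : ℂ) (a : AFA) : comp d (c • a) = c • comp d a := by
  simp [comp, -Complex.coe_smul]

theorem comp_mul (d : ℕ) (a b : AFA) :
    comp d (a * b) = ∑ p ∈ Finset.HasAntidiagonal.antidiagonal d, comp p.1 a * comp p.2 b := by
  simp [comp, coeff_mul]

/-- `a` is homogeneous of degree `d`. -/
def Homog (d : ℕ) (a : AFA) : Prop := grade a = monomial d a

theorem Homog.comp {d : ℕ} {a : AFA} (h : Homog d a) (e : ℕ) :
    QG.comp e a = if d = e then a else 0 := by
  rw [QG.comp, h, coeff_monomial]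

theorem Homog.add {d : ℕ} {a b : AFA} (h : Homog d a) (h' : Homog d b) : Homog d (a + b) := by
  unfold Homog at *; rw [map_add, h, h', map_add]

theorem Homog.sub {d : ℕ} {a b : AFA} (h : Homog d a) (h' : Homog d b) : Homog d (a - b) := by
  unfold Homog at *; rw [map_sub, h, h', map_sub]

theorem Homog.smul {d : ℕ} {a : AFA} (h : Homog d a) (c : ℂ) : Homog d (c • a) := by
  unfold Homog at *; rw [map_smul, h, smul_monomial]

theorem Homog.mul {d e : ℕ} {a b : AFA} (h : Homog d a) (h' : Homog e b) :
    Homog (d + e) (a * b) := by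
  unfold Homog at *; rw [map_mul, h, h', monomial_mul_monomial]

theorem homog_zero (d : ℕ) : Homog d 0 := by simp [Homog]
theorem homog_one : Homog 0 1 := by simp [Homog]
theorem homog_fγ (i : ℕ) : Homog 0 (fγ i) := by simp [Homog, grade]
theorem homog_fγi (i : ℕ) : Homog 0 (fγi i) := by simp [Homog, grade]
theorem homog_fβ (i : ℕ) : Homog 1 (fβ i) := by simp [Homog, grade]

theorem Homog.tp {d e : ℕ} {a b : AFA} (ha : Homog d a) (hb : Homog e b) (p s : ℂ) :
    Homog (d + d + e) (Tp p s a b) := by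
  unfold Tp
  refine Homog.add (Homog.sub (.smul ?_ _) (.smul ?_ _)) (.smul ?_ _)
  · simpa only [pow_two] using (ha.mul ha).mul hb
  · rw [add_right_comm]; exact (ha.mul hb).mul ha
  · rw [add_comm]; simpa only [pow_two] using hb.mul (ha.mul ha)

/-- A property of elements that is stable under sums and products holds everywhere once it holds
for scalars and for generators. -/
theorem afa_induction {P : AFA → Prop} (hc : ∀ c : ℂ, P (c • 1)) (hγ : ∀ i, P (fγ i))
    (hγi : ∀ i, P (fγi i)) (hβ : ∀ i, P (fβ i)) (hm : ∀ a b, P a → P b → P (a * b))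
    (ha : ∀ a b, P a → P b → P (a + b)) (a : AFA) : P a := by
  induction a using FreeAlgebra.induction with
  | grade0 c => rw [Algebra.algebraMap_eq_smul_one]; exact hc c
  | grade1 x =>
    cases x with
    | g i => exact hγ i
    | gi i => exact hγi i
    | b i => exact hβ i
  | mul a b h h' => exact hm a b h h'
  | add a b h h' => exact ha a b h h'

/-- An additive and multiplicative predicate on homogeneous elements that holds for scalars and
generators holds for the components of every element. -/
theorem comp_induction {P : ℕ → AFA → Prop} (h0 : ∀ d, P d 0) (hc : ∀ c : ℂ, P 0 (c • 1))
    (hγ : ∀ i, P 0 (fγ i)) (hγi : ∀ i, P 0 (fγi i)) (hβ : ∀ i, P 1 (fβ i))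
    (hm : ∀ d e a b, P d a → P e b → P (d + e) (a * b))
    (ha : ∀ d a b, P d a → P d b → P d (a + b)) (a : AFA) (d : ℕ) : P d (comp d a) := by
  have of_homog : ∀ {d a}, Homog d a → P d a → ∀ e, P e (comp e a) := fun {d a} h hP e => by
    rw [h.comp]
    split_ifs with hde
    · exact hde ▸ hP
    · exact h0 e
  induction a using afa_induction generalizing d with
  | hc c => exact of_homog (homog_one.smul c) (hc c) d
  | hγ i => exact of_homog (homog_fγ i) (hγ i) d
  | hγi i => exact of_homog (homog_fγi i) (hγi i) d
  | hβ i => exact of_homog (homog_fβ i) (hβ i) d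
  | ha a b iha ihb => rw [comp_add]; exact ha d _ _ (iha d) (ihb d)
  | hm a b iha ihb =>
    rw [comp_mul]
    refine Finset.sum_induction _ (P d) (ha d) (h0 d) fun p hp => ?_
    rw [← Finset.HasAntidiagonal.mem_antidiagonal.mp hp]
    exact hm _ _ _ _ (iha _) (ihb _)

theorem homog_comp (d : ℕ) (a : AFA) : Homog d (comp d a) :=
  comp_induction homog_zero homog_one.smul homog_fγ homog_fγi homog_fβ
    (fun _ _ _ _ h h' => h.mul h')
    (fun _ _ _ h h' => h.add h') a d

theorem eval_grade (a : AFA) : (grade a).eval 1 = a := by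
  induction a using afa_induction with
  | hc c => simp [-Complex.coe_smul]
  | hγ i => simp [grade]
  | hγi i => simp [grade]
  | hβ i => simp [grade]
  | ha a b iha ihb => simp [iha, ihb]
  | hm a b iha ihb =>
    rw [map_mul, eval, eval₂_mul_noncomm _ _ fun k => Commute.one_right _]
    exact congrArg₂ _ iha ihb

/-- The elements of degree less than `d` in the `β_j`. -/
noncomputable def belowDegree (d : ℕ) : Submodule ℂ AFA where
  carrier := {a | ∀ e, d ≤ e → comp e a = 0}
  add_mem' h h' e he := by rw [comp_add, h e he, h' e he, add_zero]
  zero_mem' e _ := by simp [comp]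
  smul_mem' c a h e he := by rw [comp_smul, h e he, smul_zero]

theorem mem_belowDegree {d : ℕ} {a : AFA} : a ∈ belowDegree d ↔ ∀ e, d ≤ e → comp e a = 0 := Iff.rfl

theorem exists_mem_belowDegree (a : AFA) : ∃ d, a ∈ belowDegree d :=
  ⟨(grade a).natDegree + 1, fun _ he => coeff_eq_zero_of_natDegree_lt he⟩

theorem belowDegree_zero {a : AFA} (h : a ∈ belowDegree 0) : a = 0 := by
  rw [← eval_grade a, show grade a = 0 from ext fun e => h e e.zero_le, eval_zero]

theorem Homog.mem_belowDegree {d e : ℕ} {a : AFA} (h : Homog d a) (hde : d < e) :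
    a ∈ belowDegree e := fun k hk => by rw [h.comp, if_neg (by omega)]

theorem sub_comp_mem {d : ℕ} {a : AFA} (h : a ∈ belowDegree (d + 1)) :
    a - QG.comp d a ∈ belowDegree d := fun e he => by
  rw [comp_sub, (homog_comp d a).comp]
  split_ifs with hde
  · rw [hde, sub_self]
  · rw [h e (by omega), sub_zero]

theorem Homog.mul_mem {d e : ℕ} {a b : AFA} (ha : Homog d a) (hb : b ∈ belowDegree e) :
    a * b ∈ belowDegree (d + e) := fun k hk => by
  rw [comp_mul]
  refine Finset.sum_eq_zero fun p hp => ?_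
  have := Finset.HasAntidiagonal.mem_antidiagonal.mp hp
  rw [ha.comp]
  split_ifs
  · rw [hb _ (by omega), mul_zero]
  · rw [zero_mul]

theorem Homog.mem_mul {d e : ℕ} {a b : AFA} (ha : a ∈ belowDegree d) (hb : Homog e b) :
    a * b ∈ belowDegree (d + e) := fun k hk => by
  rw [comp_mul]
  refine Finset.sum_eq_zero fun p hp => ?_
  have := Finset.HasAntidiagonal.mem_antidiagonal.mp hp
  rw [hb.comp]
  split_ifs
  · rw [ha _ (by omega), zero_mul]
  · rw [mul_zero]

end Filtration

section Associated

variable {A : Type*} [Ring A] [Algebra ℂ A]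

theorem map_homog_mul_mem (f : AFA →ₐ[ℂ] A) {d e : ℕ} {a b : AFA} (ha : Homog d a)
    (hb : f b ∈ (belowDegree e).map f.toLinearMap) :
    f (a * b) ∈ (belowDegree (d + e)).map f.toLinearMap := by
  obtain ⟨c, hc, hcb⟩ := hb
  have hcb : f c = f b := hcb
  exact ⟨a * c, ha.mul_mem hc, by simp [hcb]⟩

theorem map_mul_homog_mem (f : AFA →ₐ[ℂ] A) {d e : ℕ} {a b : AFA}
    (ha : f a ∈ (belowDegree d).map f.toLinearMap) (hb : Homog e b) :
    f (a * b) ∈ (belowDegree (d + e)).map f.toLinearMap := by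
  obtain ⟨c, hc, hca⟩ := ha
  have hca : f c = f a := hca
  exact ⟨c * b, hb.mem_mul hc, by simp [hca]⟩

/-- The elements whose components vanish under `f` up to terms of lower degree. -/
noncomputable def gradedKer (f : AFA →ₐ[ℂ] A) : Ideal AFA where
  carrier := {a | ∀ d, f (comp d a) ∈ (belowDegree d).map f.toLinearMap}
  add_mem' h h' d := by
    rw [comp_add, map_add]
    exact Submodule.add_mem _ (h d) (h' d)
  zero_mem' d := by
    rw [(homog_zero d).comp, if_pos rfl, map_zero]
    exact Submodule.zero_mem _
  smul_mem' a b h d := by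
    rw [smul_eq_mul, comp_mul, map_sum]
    refine Submodule.sum_mem _ fun p hp => ?_
    rw [← Finset.HasAntidiagonal.mem_antidiagonal.mp hp]
    exact map_homog_mul_mem f (homog_comp _ _) (h _)

theorem mem_gradedKer {f : AFA →ₐ[ℂ] A} {a : AFA} :
    a ∈ gradedKer f ↔ ∀ d, f (comp d a) ∈ (belowDegree d).map f.toLinearMap := Iff.rfl

instance (f : AFA →ₐ[ℂ] A) : (gradedKer f).IsTwoSided where
  mul_mem_of_left {a} b h d := by
    rw [comp_mul, map_sum]
    refine Submodule.sum_mem _ fun p hp => ?_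
    rw [← Finset.HasAntidiagonal.mem_antidiagonal.mp hp]
    exact map_mul_homog_mem f (h _) (homog_comp _ _)

theorem Homog.mem_gradedKer {f : AFA →ₐ[ℂ] A} {d e : ℕ} {a b : AFA} (ha : Homog d a)
    (hb : Homog e b) (hed : e < d) (hab : f a = f b) : a ∈ gradedKer f := fun k => by
  rw [ha.comp]
  split_ifs with h
  · exact h ▸ ⟨b, hb.mem_belowDegree hed, hab.symm⟩
  · rw [map_zero]; exact Submodule.zero_mem _

theorem Homog.sub_mem_gradedKer {f : AFA →ₐ[ℂ] A} {d : ℕ} {a b : AFA} (ha : Homog d a)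
    (hb : Homog d b) (hab : f a = f b) : a - b ∈ gradedKer f := fun k => by
  rw [(ha.sub hb).comp]
  split_ifs
  · rw [map_sub, hab, sub_self]; exact Submodule.zero_mem _
  · rw [map_zero]; exact Submodule.zero_mem _

theorem sub_mem_gradedKer {q : ℝ} {n : ℕ} ⦃x y : AFA⦄ (h : HRel (q : ℂ) n x y) :
    x - y ∈ gradedKer (RingQuot.mkAlgHom ℂ (ARel q n)) := by
  have rel : ∀ {x y}, ARel q n x y →
    RingQuot.mkAlgHom ℂ (ARel q n) x = RingQuot.mkAlgHom ℂ (ARel q n) y :=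
    fun h => RingQuot.mkAlgHom_rel ℂ h
  cases h with
  | gout i hi => exact (homog_fγ i).sub_mem_gradedKer homog_one (rel (.gout i hi))
  | giout i hi => exact (homog_fγi i).sub_mem_gradedKer homog_one (rel (.giout i hi))
  | bout j hj => exact (homog_fβ j).sub_mem_gradedKer (homog_zero 1) (rel (.bout j hj))
  | gg i j =>
    exact ((homog_fγ i).mul (homog_fγ j)).sub_mem_gradedKer ((homog_fγ j).mul (homog_fγ i))
      (rel (.gg i j))
  | ggi i => exact ((homog_fγ i).mul (homog_fγi i)).sub_mem_gradedKer homog_one (rel (.ggi i))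
  | gig i => exact ((homog_fγi i).mul (homog_fγ i)).sub_mem_gradedKer homog_one (rel (.gig i))
  | gsym i h1 h2 => exact (homog_fγ i).sub_mem_gradedKer (homog_fγ _) (rel (.gsym i h1 h2))
  | gb i j h1 h2 h3 h4 =>
    exact ((homog_fγ i).mul (homog_fβ j)).sub_mem_gradedKer
      (((homog_fβ j).mul (homog_fγ i)).smul _) (rel (.gb i j h1 h2 h3 h4))
  | bb i j h1 h2 h3 h4 h5 =>
    refine (((homog_fβ i).mul (homog_fβ j)).sub ((homog_fβ j).mul (homog_fβ i))).mem_gradedKer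
      (e := 0) ?_ (by omega) (rel (.bb i j h1 h2 h3 h4 h5))
    split_ifs
    · simp only [pow_two]
      exact (((homog_fγi i).mul (homog_fγi i)).sub ((homog_fγi _).mul (homog_fγi _))).smul _
    · exact homog_zero 0
  | serre_up i h1 h2 =>
    rw [sub_zero]
    refine ((homog_fβ i).tp (homog_fβ _) _ _).mem_gradedKer (e := 1) ?_ (by omega)
      (rel (.serre1 i h1 h2))
    split_ifs
    · simp only [pow_two]
      exact ((homog_fβ _).mul ((homog_fγi n).mul (homog_fγi n))).smul _
    · exact homog_zero 1
  | serre_down i h1 h2 =>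
    rw [sub_zero]
    refine ((homog_fβ i).tp (homog_fβ _) _ _).mem_gradedKer (e := 1) ?_ (by omega)
      ?_ (b := if i = n then (q : ℂ)⁻¹ • (fβ (n - 1) * fγi n ^ 2) else 0)
    · split_ifs
      · simp only [pow_two]
        exact ((homog_fβ _).mul ((homog_fγi n).mul (homog_fγi n))).smul _
      · exact homog_zero 1
    · rw [← rel (.serre2 i h1 h2), Tp, inv_inv]

theorem mem_gradedKer_of_mk_hq_eq_zero {q : ℝ} {n : ℕ} {a : AFA}
    (ha : RingQuot.mkAlgHom ℂ (HRel (q : ℂ) n) a = 0) :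
    a ∈ gradedKer (RingQuot.mkAlgHom ℂ (ARel q n)) := by
  let J := gradedKer (RingQuot.mkAlgHom ℂ (ARel q n))
  have hJ : ∀ ⦃x y⦄, HRel (q : ℂ) n x y →
      Ideal.Quotient.mkₐ ℂ J x = Ideal.Quotient.mkₐ ℂ J y := fun x y h =>
    Ideal.Quotient.eq.mpr (sub_mem_gradedKer h)
  have : RingQuot.liftAlgHom ℂ ⟨Ideal.Quotient.mkₐ ℂ J, hJ⟩
      (RingQuot.mkAlgHom ℂ (HRel (q : ℂ) n) a) = Ideal.Quotient.mkₐ ℂ J a :=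
    RingQuot.liftAlgHom_mkAlgHom_apply ..
  rw [ha, map_zero] at this
  exact Ideal.Quotient.eq_zero_iff_mem.mp this.symm

end Associated

section Injectivity

open AddMonoidAlgebra

theorem Lead.of_mem {A : Type*} [Ring A] [Algebra ℂ A] {d : ℤ} {x : AddMonoidAlgebra A ℤ}
    (h : x ∈ lowDegree A d) : Lead d x 0 := by
  unfold Lead
  rwa [AddMonoidAlgebra.single_zero, sub_zero]

theorem Lead.add_mem {A : Type*} [Ring A] [Algebra ℂ A] {d : ℤ} {x y : AddMonoidAlgebra A ℤ} {u : A}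
    (hx : Lead d x u) (hy : y ∈ lowDegree A d) : Lead d (x + y) u := by
  simpa only [add_zero] using hx.add (Lead.of_mem hy)

variable {q : ℝ} {n : ℕ}

/-- The homomorphism sending the generators to the coideal generators with parameter `t`. -/
noncomputable def coidealLift (q : ℝ) (n : ℕ) (t : ℂ) : AFA →ₐ[ℂ] Uq q (2 * n) :=
  afaLift (Cc q n) (Ccinv q n) (bGen n (uKi q (2 * n)) (uE q (2 * n)) (uF q (2 * n)) t)

theorem coidealLift_rel (hq0 : 0 < q) (hq1 : q < 1) (hn : 1 ≤ n) (t : ℂ) ⦃x y : AFA⦄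
    (h : ARel q n x y) : coidealLift q n t x = coidealLift q n t y := by
  refine (uqRep_uq q hq0.ne' (2 * n)).coideal_rel hn (by exact_mod_cast hq0.ne') ?_ h
  have : q ^ 2 - 1 ≠ 0 := by nlinarith
  exact_mod_cast this

/-- The grading of `U_q(gl(m))` by the degree in the `y_j` minus the degree in the `x_j`. -/
noncomputable def uGrade (hq : q ≠ 0) (m : ℕ) : Uq q m →ₐ[ℂ] AddMonoidAlgebra (Uq q m) ℤ :=
  (uqRep_uq q hq m).single.lift hq

theorem uGrade_bGen (hq : q ≠ 0) (t : ℂ) (j : ℕ) :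
    Lead 1 (uGrade hq (2 * n) (bGen n (uKi q (2 * n)) (uE q (2 * n)) (uF q (2 * n)) t j))
      (yPart n (uKi q (2 * n)) (uF q (2 * n)) j) := by
  simp only [bGen, yPart, xPart, map_add, map_mul, map_smul, uGrade, UqRep.lift_uKi,
    UqRep.lift_uE, UqRep.lift_uF, single_mul_single, pow_two, smul_single]
  rw [add_assoc]
  exact (Lead.single _ _).add_mem (Submodule.add_mem _ (single_mem_lowDegree (by norm_num) _)
    (single_mem_lowDegree (by norm_num) _))

theorem lead_coidealLift (hq : q ≠ 0) (t : ℂ) (a : AFA) (d : ℕ) :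
    Lead (d : ℤ) (uGrade hq (2 * n) (coidealLift q n t (comp d a)))
      (leadLift n (uK q (2 * n)) (uKi q (2 * n)) (uF q (2 * n)) (comp d a)) := by
  refine comp_induction (P := fun d a => Lead (d : ℤ) (uGrade hq (2 * n) (coidealLift q n t a))
      (leadLift n (uK q (2 * n)) (uKi q (2 * n)) (uF q (2 * n)) a))
    (fun d => ?_) (fun c => ?_) (fun i => ?_) (fun i => ?_) (fun i => ?_)
    (fun d e a b h h' => ?_) (fun d a b h h' => ?_) a d
  · rw [map_zero, map_zero, map_zero]; exact Lead.of_mem (Submodule.zero_mem _)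
  · simp only [map_smul, map_one, one_def, smul_single]; exact Lead.single _ _
  · simp only [coidealLift, leadLift, afaLift_fγ, Cc, map_mul, uGrade, UqRep.lift_uK,
      single_mul_single]
    exact Lead.single _ _
  · simp only [coidealLift, leadLift, afaLift_fγi, Ccinv, map_mul, uGrade, UqRep.lift_uKi,
      single_mul_single]
    exact Lead.single _ _
  · simp only [coidealLift, leadLift, afaLift_fβ]
    exact uGrade_bGen hq t i
  · simp only [map_mul, Nat.cast_add]; exact h.mul h'
  · simp only [map_add]; exact h.add h'

theorem uGrade_mem_lowDegree (hq : q ≠ 0) (t : ℂ) {d : ℕ} {a : AFA} (ha : a ∈ belowDegree d) :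
    uGrade hq (2 * n) (coidealLift q n t a) ∈ lowDegree (Uq q (2 * n)) d := by
  induction d generalizing a with
  | zero => simp only [belowDegree_zero ha, map_zero, Submodule.zero_mem]
  | succ d ih =>
    rw [← sub_add_cancel a (comp d a), map_add, map_add, Nat.cast_succ]
    exact Submodule.add_mem _ (lowDegree_mono (by omega) (ih (sub_comp_mem ha)))
      (lead_coidealLift hq t a d).mem

theorem leadLift_comp_eq_zero (hq : q ≠ 0) {t : ℂ} {d : ℕ} {a : AFA}
    (ha : a ∈ belowDegree (d + 1)) (h0 : coidealLift q n t a = 0) :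
    leadLift n (uK q (2 * n)) (uKi q (2 * n)) (uF q (2 * n)) (comp d a) = 0 := by
  have h1 : coidealLift q n t (comp d a) = -coidealLift q n t (a - comp d a) := by
    rw [map_sub, h0, zero_sub, neg_neg]
  rw [← (lead_coidealLift hq t a d).coeff, h1, map_neg]
  exact coeff_eq_zero_of_mem_lowDegree
    (Submodule.neg_mem _ (uGrade_mem_lowDegree hq t (sub_comp_mem ha))) le_rfl

theorem mk_eq_zero_of_coidealLift (hq0 : 0 < q) (hq1 : q < 1) (hn : 1 ≤ n) {t : ℂ} {a : AFA}
    (h0 : coidealLift q n t a = 0) : RingQuot.mkAlgHom ℂ (ARel q n) a = 0 := by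
  obtain ⟨d, hd⟩ := exists_mem_belowDegree a
  induction d generalizing a with
  | zero => rw [belowDegree_zero hd, map_zero]
  | succ d ih =>
    let π : Aalg q n →ₐ[ℂ] Uq q (2 * n) :=
      RingQuot.liftAlgHom ℂ ⟨coidealLift q n t, coidealLift_rel hq0 hq1 hn t⟩
    have hπ : ∀ x, π (RingQuot.mkAlgHom ℂ (ARel q n) x) = coidealLift q n t x :=
      fun x => RingQuot.liftAlgHom_mkAlgHom_apply ..
    have hJ := mem_gradedKer_of_mk_hq_eq_zero
      (mk_hq_eq_zero_of_uq hq0.ne' (leadLift_comp_eq_zero hq0.ne' hd h0)) d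
    rw [(homog_comp d a).comp, if_pos rfl] at hJ
    obtain ⟨b, hb, hba⟩ := hJ
    have hba : RingQuot.mkAlgHom ℂ (ARel q n) b = RingQuot.mkAlgHom ℂ (ARel q n) (comp d a) := hba
    have hmk : RingQuot.mkAlgHom ℂ (ARel q n) (a - comp d a + b) =
        RingQuot.mkAlgHom ℂ (ARel q n) a := by
      rw [map_add, map_sub, hba, sub_add_cancel]
    rw [← hmk]
    refine ih ?_ (Submodule.add_mem _ (sub_comp_mem hd) hb)
    rw [← hπ, hmk, hπ, h0]

theorem coidealLift_fβ {t : ℂ} {j : ℕ} (hj : j ≠ n) : coidealLift q n t (fβ j) = Bb q n j := by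
  simp [coidealLift, bGen, yPart, xPart, Bb, hj]

theorem coidealLift_fβ_self (q σ : ℝ) (n : ℕ) :
    coidealLift q n (((q ^ (-σ) - q ^ σ) / (q - q⁻¹) : ℝ) : ℂ) (fβ n) = Bs q σ n := by
  simp only [coidealLift, bGen, yPart, xPart, Bs, afaLift_fβ, if_true,
    show 2 * n - n = n by omega]

theorem coidealLift_ι_mem (hq : q ≠ 0) (σ : ℝ) (x : AGen) :
    coidealLift q n (((q ^ (-σ) - q ^ σ) / (q - q⁻¹) : ℝ) : ℂ) (FreeAlgebra.ι ℂ x) ∈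
      Algebra.adjoin ℂ (ASet q σ n) := by
  have h := uqRep_uq q hq (2 * n)
  cases x with
  | g i =>
    rw [← fγ, coidealLift, afaLift_fγ]
    by_cases hi : 1 ≤ i ∧ i ≤ 2 * n
    · exact Algebra.subset_adjoin (Or.inl ⟨i, hi.1, hi.2, Or.inl rfl⟩)
    · rw [Cc, h.neg.K_out i hi, h.neg.K_out _ (by omega), one_mul]
      exact one_mem _
  | gi i =>
    rw [← fγi, coidealLift, afaLift_fγi]
    by_cases hi : 1 ≤ i ∧ i ≤ 2 * n
    · exact Algebra.subset_adjoin (Or.inl ⟨i, hi.1, hi.2, Or.inr rfl⟩)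
    · rw [Ccinv, h.neg.Ki_out i hi, h.neg.Ki_out _ (by omega), one_mul]
      exact one_mem _
  | b j =>
    rw [← fβ]
    by_cases hj : j = n
    · rw [hj, coidealLift_fβ_self]
      exact Algebra.subset_adjoin (Or.inr (Or.inr rfl))
    · rw [coidealLift_fβ hj]
      by_cases hj' : 1 ≤ j ∧ j + 1 ≤ 2 * n
      · exact Algebra.subset_adjoin (Or.inr (Or.inl ⟨j, hj'.1, hj'.2, hj, rfl⟩))
      · rw [Bb, h.neg.F_out j hj', h.pos.F_out (2 * n - j) (by omega), zero_mul, zero_mul, mul_zero,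
          zero_mul, add_zero]
        exact zero_mem _

theorem range_coidealLift (hq : q ≠ 0) (σ : ℝ) :
    (coidealLift q n (((q ^ (-σ) - q ^ σ) / (q - q⁻¹) : ℝ) : ℂ)).range =
      Algebra.adjoin ℂ (ASet q σ n) := by
  refine le_antisymm ?_ (Algebra.adjoin_le ?_)
  · rw [← Algebra.map_top, ← FreeAlgebra.adjoin_range_ι, AlgHom.map_adjoin, Algebra.adjoin_le_iff]
    rintro _ ⟨_, ⟨x, rfl⟩, rfl⟩
    exact coidealLift_ι_mem hq σ x
  · rintro z (⟨i, -, -, rfl | rfl⟩ | ⟨j, -, -, hj, rfl⟩ | rfl)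
    · exact ⟨fγ i, afaLift_fγ ..⟩
    · exact ⟨fγi i, afaLift_fγi ..⟩
    · exact ⟨fβ j, coidealLift_fβ hj⟩
    · exact ⟨fβ n, coidealLift_fβ_self q σ n⟩

end Injectivity

end QG

open QG in
/-- For every `σ ∈ ℝ`, the assignment `γ_i^{±1} ↦ C_i^{±1}`, `β_j ↦ B_j` (`j ≠ n`),
`β_n ↦ B_n^σ` extends to an algebra homomorphism `π_σ : 𝒜 → U_q(g)`, which is injective;
in particular it is an isomorphism from `𝒜` onto the subalgebra `𝒜_σ`. -/
theorem statement_6 (q : ℝ) (hq0 : 0 < q) (hq1 : q < 1) (n : ℕ) (hn : 1 ≤ n) (σ : ℝ) :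
    ∃ π : Aalg q n →ₐ[ℂ] Uq q (2*n),
      (∀ i, 1 ≤ i → i ≤ 2*n → π (aγ q n i) = Cc q n i) ∧
      (∀ i, 1 ≤ i → i ≤ 2*n → π (aγi q n i) = Ccinv q n i) ∧
      (∀ j, 1 ≤ j → j + 1 ≤ 2*n → j ≠ n → π (aβ q n j) = Bb q n j) ∧
      π (aβ q n n) = Bs q σ n ∧
      Function.Injective π ∧
      π.range = Algebra.adjoin ℂ (ASet q σ n) := by
  let f := coidealLift q n (((q ^ (-σ) - q ^ σ) / (q - q⁻¹) : ℝ) : ℂ)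
  let π : Aalg q n →ₐ[ℂ] Uq q (2 * n) :=
    RingQuot.liftAlgHom ℂ ⟨f, coidealLift_rel hq0 hq1 hn _⟩
  have hπ : ∀ x, π (RingQuot.mkAlgHom ℂ (ARel q n) x) = f x :=
    fun x => RingQuot.liftAlgHom_mkAlgHom_apply ..
  have hs := RingQuot.mkAlgHom_surjective ℂ (ARel q n)
  refine ⟨π, fun i _ _ => (hπ _).trans (afaLift_fγ ..), fun i _ _ => (hπ _).trans (afaLift_fγi ..),
    fun j _ _ hj => (hπ _).trans (coidealLift_fβ hj), (hπ _).trans (coidealLift_fβ_self q σ n), ?_,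
    ?_⟩
  · refine (injective_iff_map_eq_zero π).mpr fun x hx => ?_
    obtain ⟨a, rfl⟩ := hs x
    exact mk_eq_zero_of_coidealLift hq0 hq1 hn ((hπ a).symm.trans hx)
  · rw [← range_coidealLift hq0.ne' σ]
    ext z
    constructor
    · rintro ⟨x, rfl⟩
      obtain ⟨a, rfl⟩ := hs x
      exact ⟨a, (hπ a).symm⟩
    · rintro ⟨a, rfl⟩
      exact ⟨_, hπ a⟩
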